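/- Let A, D ∈ ℂ^{n×n} and let E ⊆ ℂ be a compact convex set containing the union of the numerical ranges W(A) and W(A+D). Then for every polynomial p (whose derivative is p′): ‖p(A+D) − p(A)‖_F ≤ (1+√2)² · (sup_{z∈E} |p′(z)|) · ‖D‖_F. -/

import Mathlib

open Polynomial Matrix

/-- The numerical range `W(A) = { xᴴ A x : ‖x‖₂ = 1 }` of a square complex matrix. -/
def numRange {k : ℕ} (A : Matrix (Fin k) (Fin k) ℂ) : Set ℂ :=
  {z | ∃ x : Fin k → ℂ, star x ⬝ᵥ x = 1 ∧ z = star x ⬝ᵥ A.mulVec x}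

/-- The Frobenius norm of a matrix. -/
noncomputable def frobNorm {k l : ℕ} (M : Matrix (Fin k) (Fin l) ℂ) : ℝ :=
  Real.sqrt (∑ i, ∑ j, ‖M i j‖ ^ 2)


structure GaugeLike (g : ℂ → ℝ) (m M : ℝ) : Prop where
  hm : 0 < m
  hM : 0 < M
  hom : ∀ t : ℝ, 0 ≤ t → ∀ z : ℂ, g ((t : ℂ) * z) = t * g z
  add : ∀ z w : ℂ, g (z + w) ≤ g z + g w
  lower : ∀ z : ℂ, m * ‖z‖ ≤ g z
  upper : ∀ z : ℂ, g z ≤ M * ‖z‖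

/-- The twice signed area of the triangle `z a b`. -/
noncomputable def orient (z a b : ℂ) : ℝ := ((starRingEnd ℂ (a - z)) * (b - z)).im

noncomputable def bdry (g : ℂ → ℝ) (θ : ℝ) : ℂ :=
  Complex.exp (θ * Complex.I) / (g (Complex.exp (θ * Complex.I)) : ℂ)

noncomputable def vert (g : ℂ → ℝ) (N : ℕ) (k : ℕ) : ℂ := bdry g (k * (2 * Real.pi / N))

lemma orient_eq (z a b : ℂ) : orient z a b =
    (a.re - z.re) * (b.im - z.im) - (a.im - z.im) * (b.re - z.re) := by
  simp [orient]; ring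

namespace GaugeLike
variable {g : ℂ → ℝ} {m M : ℝ}

lemma nonneg (h : GaugeLike g m M) (z : ℂ) : 0 ≤ g z :=
  le_trans (mul_nonneg h.hm.le (norm_nonneg z)) (h.lower z)

lemma exp_pos (h : GaugeLike g m M) (θ : ℝ) : 0 < g (Complex.exp (θ * Complex.I)) := by
  have := h.lower (Complex.exp (θ * Complex.I))
  rw [Complex.norm_exp_ofReal_mul_I] at this
  linarith [h.hm]

lemma le_exp (h : GaugeLike g m M) (θ : ℝ) : m ≤ g (Complex.exp (θ * Complex.I)) := by
  have := h.lower (Complex.exp (θ * Complex.I))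
  rw [Complex.norm_exp_ofReal_mul_I] at this
  linarith [h.hm]

lemma sub_le (h : GaugeLike g m M) (z w : ℂ) : g z - g w ≤ M * ‖z - w‖ := by
  have h1 := h.add (z - w) w
  have h2 := h.upper (z - w)
  simp at h1; linarith

lemma abs_sub_le (h : GaugeLike g m M) (z w : ℂ) : |g z - g w| ≤ M * ‖z - w‖ := by
  rw [abs_le]
  have := h.sub_le z w
  have h2 := h.sub_le w z
  rw [norm_sub_rev] at h2
  constructor <;> linarith

lemma cont (h : GaugeLike g m M) : Continuous g := by
  have : LipschitzWith ⟨M, h.hM.le⟩ g := by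
    apply LipschitzWith.of_dist_le_mul
    intro z w
    rw [Real.dist_eq, dist_eq_norm]
    exact h.abs_sub_le z w
  exact this.continuous

lemma bdry_eq (θ : ℝ) : bdry g θ =
    (((g (Complex.exp (θ * Complex.I)))⁻¹ : ℝ) : ℂ) * Complex.exp (θ * Complex.I) := by
  rw [bdry, div_eq_inv_mul]; push_cast; rfl

lemma g_bdry (h : GaugeLike g m M) (θ : ℝ) : g (bdry g θ) = 1 := by
  rw [bdry_eq, h.hom _ (inv_nonneg.2 (h.exp_pos θ).le), inv_mul_cancel₀ (h.exp_pos θ).ne']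

lemma norm_bdry_le (h : GaugeLike g m M) (θ : ℝ) : ‖bdry g θ‖ ≤ 1 / m := by
  have := h.lower (bdry g θ)
  rw [h.g_bdry] at this
  rw [le_div_iff₀ h.hm]; linarith

lemma norm_exp_sub (θ φ : ℝ) :
    ‖Complex.exp (θ * Complex.I) - Complex.exp (φ * Complex.I)‖ ≤ |θ - φ| := by
  have h1 : Complex.exp (θ * Complex.I) - Complex.exp (φ * Complex.I)
      = Complex.exp (φ * Complex.I) * (Complex.exp (Complex.I * ((θ - φ : ℝ) : ℂ)) - 1) := by
    rw [mul_sub, ← Complex.exp_add]; push_cast; ring_nf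
  rw [h1, norm_mul, Complex.norm_exp_ofReal_mul_I, one_mul]
  simpa using Real.norm_exp_I_mul_ofReal_sub_one_le (x := θ - φ)

lemma bdry_lip (h : GaugeLike g m M) (θ φ : ℝ) :
    ‖bdry g θ - bdry g φ‖ ≤ (1 / m + M / m ^ 2) * |θ - φ| := by
  set a := Complex.exp (θ * Complex.I) with ha
  set b := Complex.exp (φ * Complex.I) with hb
  have hga : m ≤ g a := h.le_exp θ
  have hgb : m ≤ g b := h.le_exp φ
  have hm := h.hm
  have hga0 : 0 < g a := by linarith
  have hgb0 : 0 < g b := by linarith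
  have hab : ‖a - b‖ ≤ |θ - φ| := norm_exp_sub θ φ
  have hnb : ‖b‖ = 1 := Complex.norm_exp_ofReal_mul_I φ
  have e : bdry g θ - bdry g φ =
      (((g a)⁻¹ : ℝ) : ℂ) * (a - b) + (((g b - g a) / (g a * g b) : ℝ) : ℂ) * b := by
    rw [bdry_eq, bdry_eq]
    have : (g b - g a) / (g a * g b) = (g a)⁻¹ - (g b)⁻¹ := by field_simp
    rw [this]; push_cast; ring
  rw [e]
  refine (norm_add_le _ _).trans ?_
  rw [norm_mul, norm_mul, hnb, mul_one, Complex.norm_real, Complex.norm_real, Real.norm_eq_abs,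
    Real.norm_eq_abs, abs_div, abs_of_pos (inv_pos.2 hga0), abs_of_pos (mul_pos hga0 hgb0), add_mul]
  have h1 : (g a)⁻¹ ≤ 1 / m := by rw [← one_div]; exact one_div_le_one_div_of_le hm hga
  have h2 : |g b - g a| ≤ M * |θ - φ| := by
    refine (h.abs_sub_le b a).trans ?_
    rw [norm_sub_rev]
    exact mul_le_mul_of_nonneg_left hab h.hM.le
  have h3 : m ^ 2 ≤ g a * g b := by nlinarith
  gcongr
  calc |g b - g a| / (g a * g b) ≤ (M * |θ - φ|) / m ^ 2 := by
        gcongr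
        have := h.hM
        positivity
    _ = _ := by ring

/-- half plane lemma in coordinates -/
lemma coord_le (h : GaugeLike g m M) {a b : ℂ} (ha : g a = 1) (hb : g b = 1) {α β : ℝ}
    (hs : α ≤ 0 ∨ β ≤ 0) : α + β ≤ g ((α : ℂ) * a + (β : ℂ) * b) := by
  have key : ∀ (a b : ℂ) (α β : ℝ), g a = 1 → g b = 1 → β ≤ 0 →
      α + β ≤ g ((α : ℂ) * a + (β : ℂ) * b) := by
    intro a b α β ha hb hβ
    rcases le_or_gt α 0 with hα | hα
    · linarith [h.nonneg ((α : ℂ) * a + (β : ℂ) * b)]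
    · have h1 := h.add ((α : ℂ) * a + (β : ℂ) * b) (((-β : ℝ) : ℂ) * b)
      rw [h.hom (-β) (by linarith) b, hb] at h1
      have e : (α : ℂ) * a + (β : ℂ) * b + (((-β : ℝ) : ℂ) * b) = (α : ℂ) * a := by push_cast; ring
      rw [e, h.hom α hα.le, ha] at h1
      linarith
  rcases hs with hs | hs
  · have := key b a β α hb ha hs
    rw [add_comm β α, add_comm (_ * b)] at this; exact this
  · exact key a b α β ha hb hs

lemma coord_lt (h : GaugeLike g m M) {a b : ℂ} (ha : g a = 1) (hb : g b = 1) {α β c : ℝ}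
    (hc : c < 1) (hab : M * ‖a - b‖ < 1 - c)
    (hz : g ((α : ℂ) * a + (β : ℂ) * b) ≤ c) : α + β < 1 := by
  by_cases hs : α ≤ 0 ∨ β ≤ 0
  · linarith [h.coord_le ha hb hs]
  · push Not at hs
    obtain ⟨hα, hβ⟩ := hs
    by_contra hcon
    push Not at hcon
    have h1 := h.add ((α : ℂ) * a + (β : ℂ) * b) ((β : ℂ) * (a - b))
    have e : (α : ℂ) * a + (β : ℂ) * b + ((β : ℂ) * (a - b)) = ((α + β : ℝ) : ℂ) * a := by
      push_cast; ring
    rw [e, h.hom _ (by linarith), ha, h.hom _ hβ.le] at h1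
    have h2 := h.upper (a - b)
    have h0 := h.nonneg ((α : ℂ) * a + (β : ℂ) * b)
    have h4 := mul_nonneg h.hM.le (norm_nonneg (a - b))
    have h3 : β * g (a - b) ≤ (α + β) * (M * ‖a - b‖) := by
      calc β * g (a - b) ≤ β * (M * ‖a - b‖) := by gcongr
        _ ≤ _ := by gcongr; linarith
    nlinarith

lemma coords {a b z : ℂ} (hX : 0 < orient 0 a b) :
    z = ((orient 0 z b / orient 0 a b : ℝ) : ℂ) * a + ((orient 0 a z / orient 0 a b : ℝ) : ℂ) * b ∧
    orient z a b = orient 0 a b * (1 - (orient 0 z b / orient 0 a b + orient 0 a z / orient 0 a b)) := by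
  have hX' := hX.ne'
  have e1 : orient 0 z b / orient 0 a b * orient 0 a b = orient 0 z b := by field_simp
  have e2 : orient 0 a z / orient 0 a b * orient 0 a b = orient 0 a z := by field_simp
  constructor
  · apply Complex.ext
    · simp only [Complex.add_re, Complex.re_ofReal_mul]
      field_simp
      simp only [orient_eq, Complex.zero_re, Complex.zero_im]; ring
    · simp only [Complex.add_im, Complex.im_ofReal_mul]
      field_simp
      simp only [orient_eq, Complex.zero_re, Complex.zero_im]; ring
  · rw [mul_sub, mul_add, mul_comm (orient 0 a b) (_ / _), mul_comm (orient 0 a b) (_ / _), e1, e2]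
    simp only [orient_eq, Complex.zero_re, Complex.zero_im]; ring

lemma orient_pos (h : GaugeLike g m M) {a b z : ℂ} (ha : g a = 1) (hb : g b = 1)
    (hX : 0 < orient 0 a b) {c : ℝ} (hc : c < 1) (hab : M * ‖a - b‖ < 1 - c) (hz : g z ≤ c) :
    0 < orient z a b := by
  obtain ⟨e1, e2⟩ := coords (z := z) hX
  rw [e2]
  rw [e1] at hz
  have := h.coord_lt ha hb hc hab hz
  apply mul_pos hX; linarith

lemma orient_nonneg (h : GaugeLike g m M) {a b z : ℂ} (ha : g a = 1) (hb : g b = 1)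
    (hX : 0 < orient 0 a b) (hs : orient 0 z b ≤ 0 ∨ orient 0 a z ≤ 0) (hz : g z ≤ 1) :
    0 ≤ orient z a b := by
  obtain ⟨e1, e2⟩ := coords (z := z) hX
  rw [e2]
  rw [e1] at hz
  have hs' : orient 0 z b / orient 0 a b ≤ 0 ∨ orient 0 a z / orient 0 a b ≤ 0 :=
    hs.imp (fun h => div_nonpos_of_nonpos_of_nonneg h hX.le) (fun h => div_nonpos_of_nonpos_of_nonneg h hX.le)
  have := h.coord_le ha hb hs'
  apply mul_nonneg hX.le; linarith

lemma orient_bdry (θ φ : ℝ) : orient 0 (bdry g θ) (bdry g φ) =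
    (g (Complex.exp (θ * Complex.I)))⁻¹ * (g (Complex.exp (φ * Complex.I)))⁻¹ * Real.sin (φ - θ) := by
  rw [orient_eq, bdry_eq, bdry_eq, Complex.re_ofReal_mul, Complex.im_ofReal_mul,
    Complex.re_ofReal_mul, Complex.im_ofReal_mul, Complex.exp_ofReal_mul_I_re,
    Complex.exp_ofReal_mul_I_im, Complex.exp_ofReal_mul_I_re,
    Complex.exp_ofReal_mul_I_im, Real.sin_sub]
  simp; ring

lemma bdry_periodic (θ : ℝ) : bdry g (θ + 2 * Real.pi) = bdry g θ := by
  have : Complex.exp (((θ + 2 * Real.pi : ℝ) : ℂ) * Complex.I) = Complex.exp (θ * Complex.I) := by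
    push_cast
    rw [add_mul]
    exact Complex.exp_periodic _
  rw [bdry, bdry, this]

lemma vert_periodic {N : ℕ} (hN : N ≠ 0) (k : ℕ) : vert g N (k + N) = vert g N k := by
  rw [vert, vert, ← bdry_periodic (g := g) (k * _)]
  congr 1
  have : (N : ℝ) ≠ 0 := by exact_mod_cast hN
  push_cast; field_simp

lemma orient_vert (h : GaugeLike g m M) (N k l : ℕ) : ∃ r : ℝ, 0 < r ∧
    orient 0 (vert g N k) (vert g N l) = r * Real.sin (((l : ℝ) - k) * (2 * Real.pi / N)) := by
  refine ⟨_, mul_pos (inv_pos.2 (h.exp_pos (k * (2 * Real.pi / N))))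
    (inv_pos.2 (h.exp_pos (l * (2 * Real.pi / N)))), ?_⟩
  rw [vert, vert, orient_bdry, sub_mul]

lemma orient_vert_succ (h : GaugeLike g m M) {N : ℕ} (hN : 3 ≤ N) (k : ℕ) :
    0 < orient 0 (vert g N k) (vert g N (k + 1)) := by
  obtain ⟨r, hr, e⟩ := h.orient_vert N k (k + 1)
  rw [e]
  apply mul_pos hr
  push_cast
  have hN' : (3 : ℝ) ≤ N := by exact_mod_cast hN
  have hp := Real.pi_pos
  apply Real.sin_pos_of_pos_of_lt_pi
  · simp; positivity
  · simp
    rw [div_lt_iff₀ (by linarith)]; nlinarith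

lemma sector (h : GaugeLike g m M) {N : ℕ} (hN : 3 ≤ N) (k i : ℕ) (hi : 2 ≤ i) (hiN : i < N) :
    orient 0 (vert g N (k + i)) (vert g N (k + 1)) ≤ 0 ∨ orient 0 (vert g N k) (vert g N (k + i)) ≤ 0 := by
  obtain ⟨r, hr, e⟩ := h.orient_vert N (k + i) (k + 1)
  obtain ⟨r', hr', e'⟩ := h.orient_vert N k (k + i)
  rw [e, e']
  have hN' : (3 : ℝ) ≤ N := by exact_mod_cast hN
  have hN0 : (0 : ℝ) < N := by linarith
  have hi' : (2 : ℝ) ≤ i := by exact_mod_cast hi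
  have hiN' : (i : ℝ) + 1 ≤ N := by exact_mod_cast hiN
  have hp := Real.pi_pos
  push_cast
  have e1 : ((k : ℝ) + 1 - (k + i)) * (2 * Real.pi / N) = -((i - 1) * (2 * Real.pi / N)) := by ring
  have e2 : ((k : ℝ) + i - k) * (2 * Real.pi / N) = i * (2 * Real.pi / N) := by ring
  rw [e1, e2, Real.sin_neg]
  have hh : 0 < 2 * Real.pi / N := by positivity
  have hlt : (i : ℝ) * (2 * Real.pi / N) ≤ 2 * Real.pi := by
    rw [mul_div_assoc', div_le_iff₀ hN0]; nlinarith
  rcases le_or_gt ((i : ℝ) * (2 * Real.pi / N)) Real.pi with h1 | h1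
  · left
    have : 0 ≤ Real.sin (((i : ℝ) - 1) * (2 * Real.pi / N)) := by
      apply Real.sin_nonneg_of_nonneg_of_le_pi
      · apply mul_nonneg _ hh.le; linarith
      · nlinarith
    nlinarith
  · right
    have : Real.sin ((i : ℝ) * (2 * Real.pi / N)) ≤ 0 := by
      have h2 : 0 ≤ Real.sin ((i : ℝ) * (2 * Real.pi / N) - Real.pi) := by
        apply Real.sin_nonneg_of_nonneg_of_le_pi <;> linarith
      rw [Real.sin_sub_pi] at h2; linarith
    nlinarith

lemma vert_ne (h : GaugeLike g m M) {N : ℕ} (hN : 3 ≤ N) (k i : ℕ) (hi : 1 ≤ i) (hiN : i < N) :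
    vert g N (k + i) ≠ vert g N k := by
  intro heq
  have hN0 : (0 : ℝ) < N := by exact_mod_cast (by omega : 0 < N)
  have hN0' : (N : ℂ) ≠ 0 := by exact_mod_cast hN0.ne'
  rw [vert, vert, bdry, bdry] at heq
  have h1 := congrArg (fun z : ℂ => z / (‖z‖ : ℂ)) heq
  have key : ∀ θ : ℝ, (Complex.exp (θ * Complex.I) / (g (Complex.exp (θ * Complex.I)) : ℂ)) /
      (‖Complex.exp (θ * Complex.I) / (g (Complex.exp (θ * Complex.I)) : ℂ)‖ : ℂ)
        = Complex.exp (θ * Complex.I) := by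
    intro θ
    rw [norm_div, Complex.norm_exp_ofReal_mul_I, Complex.norm_real, Real.norm_eq_abs,
      abs_of_pos (h.exp_pos θ)]
    have : (g (Complex.exp (θ * Complex.I)) : ℂ) ≠ 0 := by exact_mod_cast (h.exp_pos θ).ne'
    push_cast
    field_simp
  rw [key, key, Complex.exp_eq_exp_iff_exists_int] at h1
  obtain ⟨n, hn⟩ := h1
  have hpi : (Real.pi : ℂ) ≠ 0 := by exact_mod_cast Real.pi_ne_zero
  have h2 : ((i : ℂ)) = n * N := by
    push_cast at hn
    have hI := Complex.I_ne_zero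
    field_simp at hn
    linear_combination hn
  have h3 : (i : ℤ) = n * N := by exact_mod_cast h2
  have h4 : (N : ℤ) ∣ i := ⟨n, by rw [h3, mul_comm]⟩
  have := Nat.le_of_dvd (by omega) (Int.natCast_dvd_natCast.1 h4)
  omega

end GaugeLike

noncomputable def lg (a b z : ℂ) : ℂ := Complex.log ((b - z) / (a - z))

lemma im_div_eq (a b z : ℂ) : ((b - z) / (a - z)).im = orient z a b / Complex.normSq (a - z) := by
  rw [Complex.div_im, orient_eq]; simp; ring

lemma im_div_pos {a b z : ℂ} (h : 0 < orient z a b) : 0 < ((b - z) / (a - z)).im := by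
  rw [im_div_eq]
  apply div_pos h
  rw [Complex.normSq_pos]
  rintro h0
  rw [orient, h0] at h; simp at h

lemma im_div_nonneg {a b z : ℂ} (h : 0 ≤ orient z a b) : 0 ≤ ((b - z) / (a - z)).im := by
  rw [im_div_eq]
  exact div_nonneg h (Complex.normSq_nonneg _)

lemma slit_of_orient {a b z : ℂ} (h : 0 < orient z a b) : (b - z) / (a - z) ∈ Complex.slitPlane := by
  rw [Complex.mem_slitPlane_iff]; right; exact (im_div_pos h).ne'

lemma lg_hasDerivAt {a b z : ℂ} (h : (b - z) / (a - z) ∈ Complex.slitPlane) :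
    HasDerivAt (lg a b) (1 / (a - z) - 1 / (b - z)) z := by
  have h0 : (b - z) / (a - z) ≠ 0 := Complex.slitPlane_ne_zero h
  have ha : a - z ≠ 0 := fun h1 => h0 (by simp [h1])
  have hb : b - z ≠ 0 := fun h1 => h0 (by simp [h1])
  have h1 : HasDerivAt (fun z => (b - z) / (a - z)) ((-1 * (a - z) - (b - z) * -1) / (a - z) ^ 2) z :=
    ((hasDerivAt_id z).const_sub b).div ((hasDerivAt_id z).const_sub a) ha
  have h2 := h1.clog h
  convert! h2 using 1
  field_simp
  ring

lemma sum_range_shift {β : Type*} [AddCommMonoid β] {N : ℕ} (f : ℕ → β) (hf : ∀ k, f (k + N) = f k) (j : ℕ) :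
    ∑ k ∈ Finset.range N, f (j + k) = ∑ k ∈ Finset.range N, f k := by
  induction j with
  | zero => simp
  | succ j ih =>
    rw [← ih]
    cases N with
    | zero => simp
    | succ n =>
      rw [Finset.sum_range_succ, Finset.sum_range_succ']
      congr 1
      · apply Finset.sum_congr rfl; intro k _; congr 1; ring
      · rw [add_zero, ← hf j]; congr 1; ring

namespace GaugeLike
variable {g : ℂ → ℝ} {m M : ℝ}

lemma g_vert (h : GaugeLike g m M) (N k : ℕ) : g (vert g N k) = 1 := h.g_bdry _

lemma lg_zero (h : GaugeLike g m M) {N : ℕ} (hN : 3 ≤ N) (k : ℕ) :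
    lg (vert g N k) (vert g N (k + 1)) 0 =
      ((Real.log ‖vert g N (k + 1)‖ - Real.log ‖vert g N k‖ : ℝ) : ℂ) + (2 * Real.pi / N : ℝ) * Complex.I := by
  have hN' : (3 : ℝ) ≤ N := by exact_mod_cast hN
  have hp := Real.pi_pos
  have nv : ∀ θ : ℝ, ‖bdry g θ‖ = (g (Complex.exp (θ * Complex.I)))⁻¹ := by
    intro θ
    rw [bdry_eq, norm_mul, Complex.norm_exp_ofReal_mul_I, Complex.norm_real, Real.norm_eq_abs,
      abs_of_pos (inv_pos.2 (h.exp_pos θ)), mul_one]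
  have e : (vert g N (k + 1) - 0) / (vert g N k - 0) =
      ((‖vert g N (k + 1)‖ / ‖vert g N k‖ : ℝ) : ℂ) * Complex.exp ((2 * Real.pi / N : ℝ) * Complex.I) := by
    have hexp : Complex.exp ((((k + 1 : ℕ) : ℝ) * (2 * Real.pi / N) : ℝ) * Complex.I) =
        Complex.exp (((k : ℝ) * (2 * Real.pi / N) : ℝ) * Complex.I) * Complex.exp ((2 * Real.pi / N : ℝ) * Complex.I) := by
      rw [← Complex.exp_add]; push_cast; ring_nf
    rw [sub_zero, sub_zero, vert, vert, nv, nv, bdry_eq, bdry_eq, hexp]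
    have h1 := Complex.exp_ne_zero (((k : ℝ) * (2 * Real.pi / N) : ℝ) * Complex.I)
    have h2 : ((g (Complex.exp (((k : ℝ) * (2 * Real.pi / N) : ℝ) * Complex.I)) : ℝ) : ℂ) ≠ 0 := by
      exact_mod_cast (h.exp_pos _).ne'
    push_cast at h1 h2 ⊢
    field_simp
  have hv : ∀ k, 0 < ‖vert g N k‖ := by
    intro k; rw [vert, nv]; exact inv_pos.2 (h.exp_pos _)
  rw [lg, e, Complex.log_ofReal_mul (div_pos (hv _) (hv _)) (Complex.exp_ne_zero _), Complex.log_exp,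
    Real.log_div (hv _).ne' (hv _).ne']
  · simp
    have : 0 < 2 * Real.pi / N := by positivity
    linarith
  · simp
    rw [div_le_iff₀ (by linarith)]; nlinarith

lemma sum_lg (h : GaugeLike g m M) {N : ℕ} (hN : 3 ≤ N) {c : ℝ} (hc : c < 1)
    (hs : ∀ k, M * ‖vert g N k - vert g N (k + 1)‖ < 1 - c) {z : ℂ} (hz : g z ≤ c) :
    ∑ k ∈ Finset.range N, lg (vert g N k) (vert g N (k + 1)) z = 2 * Real.pi * Complex.I := by
  have hper : vert g N N = vert g N 0 := by
    have := vert_periodic (g := g) (N := N) (by omega) 0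
    simpa using this
  have hor : ∀ t : ℝ, t ∈ Set.Icc (0 : ℝ) 1 → ∀ k, 0 < orient (t * z) (vert g N k) (vert g N (k + 1)) := by
    intro t ht k
    refine h.orient_pos (h.g_vert N k) (h.g_vert N (k + 1)) (h.orient_vert_succ hN k) hc (hs k) ?_
    rw [h.hom t ht.1]
    nlinarith [ht.1, ht.2, h.nonneg z]
  have hd : ∀ t : ℝ, t ∈ Set.Icc (0 : ℝ) 1 →
      HasDerivAt (fun t : ℝ => ∑ k ∈ Finset.range N, lg (vert g N k) (vert g N (k + 1)) (t * z)) 0 t := by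
    intro t ht
    have h1 : ∀ k ∈ Finset.range N, HasDerivAt (fun t : ℝ => lg (vert g N k) (vert g N (k + 1)) (t * z))
        ((1 / (vert g N k - t * z) - 1 / (vert g N (k + 1) - t * z)) * z) t := by
      intro k _
      have := lg_hasDerivAt (slit_of_orient (hor t ht k))
      have h2 : HasDerivAt (fun t : ℝ => (t : ℂ) * z) z t := by
        simpa using (Complex.ofRealCLM.hasDerivAt (x := t)).mul_const z
      exact HasDerivAt.comp (h₂ := lg (vert g N k) (vert g N (k + 1))) t this h2
    have h3 := HasDerivAt.fun_sum h1
    convert! h3 using 1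
    rw [← Finset.sum_mul, Finset.sum_range_sub' (fun k => 1 / (vert g N k - t * z)), hper, sub_self, zero_mul]
  have hconst := constant_of_has_deriv_right_zero (a := 0) (b := 1)
    (fun t ht => (hd t ht).continuousAt.continuousWithinAt)
    (fun t ht => (hd t ⟨ht.1, ht.2.le⟩).hasDerivWithinAt) 1 (by simp)
  simp only [Complex.ofReal_one, one_mul, Complex.ofReal_zero, zero_mul] at hconst
  rw [hconst, Finset.sum_congr rfl (fun k _ => h.lg_zero hN k), Finset.sum_add_distrib, ← Complex.ofReal_sum,
    Finset.sum_range_sub (fun k => Real.log ‖vert g N k‖), hper]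
  have : (N : ℂ) ≠ 0 := by exact_mod_cast (by omega : N ≠ 0)
  simp
  field_simp

lemma arg_add_of_nonneg {q x : ℂ} (hq : q ≠ 0) (hx : x ≠ 0) (h1 : 0 ≤ q.im) (h1' : q.arg ≠ Real.pi)
    (h2 : 0 ≤ x.im) (h3 : 0 ≤ (q * x).im) : (q * x).arg = q.arg + x.arg := by
  rw [Complex.arg_mul_eq_add_arg_iff hq hx]
  have a1 := Complex.arg_nonneg_iff.2 h1
  have a2 := Complex.arg_nonneg_iff.2 h2
  have a3 := Complex.arg_nonneg_iff.2 h3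
  have a4 := Complex.arg_le_pi q
  have a5 := Complex.arg_le_pi x
  have a6 := Complex.arg_le_pi (q * x)
  have hp := Real.pi_pos
  refine ⟨by linarith, ?_⟩
  by_contra hcon
  push Not at hcon
  have hlt : q.arg < Real.pi := lt_of_le_of_ne a4 h1'
  have h4 := Complex.arg_mul_coe_angle hq hx
  rw [← Real.Angle.coe_add, Real.Angle.angle_eq_iff_two_pi_dvd_sub] at h4
  obtain ⟨k, hk⟩ := h4
  have b1 : (k : ℝ) < 0 := by
    by_contra hc; push Not at hc; nlinarith
  have b2 : (-1 : ℝ) < k := by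
    by_contra hc; push Not at hc; nlinarith
  have b1' : k < 0 := by exact_mod_cast b1
  have b2' : -1 < k := by exact_mod_cast b2
  omega

lemma orient_cyc (a b z : ℂ) : orient z a b = orient a b z := by
  rw [orient_eq, orient_eq]; ring

lemma vertex_orient (h : GaugeLike g m M) {N : ℕ} (hN : 3 ≤ N) (k i : ℕ) (hi : 2 ≤ i) (hiN : i < N) :
    0 ≤ orient (vert g N (k + i)) (vert g N k) (vert g N (k + 1)) :=
  h.orient_nonneg (h.g_vert _ _) (h.g_vert _ _) (h.orient_vert_succ hN k) (h.sector hN k i hi hiN)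
    (h.g_vert _ _).le

/-- as seen from vertex `j` the edge from `j+i` to `j+i+1`. -/
lemma vertex_edge (h : GaugeLike g m M) {N : ℕ} (hN : 3 ≤ N) (j i : ℕ) (hi : 1 ≤ i) (hiN : i + 1 < N) :
    0 ≤ orient (vert g N j) (vert g N (j + i)) (vert g N (j + i + 1)) ∧
    ((vert g N (j + i + 1) - vert g N j) / (vert g N (j + i) - vert g N j)).arg ≠ Real.pi := by
  have hvj : vert g N (j + i + (N - i)) = vert g N j := by
    rw [← vert_periodic (g := g) (N := N) (by omega) j]; congr 1; omega
  have h1 := h.vertex_orient hN (j + i) (N - i) (by omega) (by omega)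
  have h2 := h.sector hN (j + i) (N - i) (by omega) (by omega)
  rw [hvj] at h1 h2
  refine ⟨h1, ?_⟩
  intro harg
  rw [Complex.arg_eq_pi_iff] at harg
  have hX := h.orient_vert_succ hN (j + i)
  set a := vert g N (j + i)
  set b := vert g N (j + i + 1)
  set v := vert g N j
  have hav : a - v ≠ 0 := by
    intro h0; rw [h0] at harg; simp at harg
  set q := (b - v) / (a - v) with hq
  have hb : b - v = q * (a - v) := by rw [hq]; field_simp
  have hre : (b.re - v.re) = q.re * (a.re - v.re) := by
    have := congrArg Complex.re hb
    simpa [harg.2] using this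
  have him : (b.im - v.im) = q.re * (a.im - v.im) := by
    have := congrArg Complex.im hb
    simpa [harg.2] using this
  have hs := harg.1
  simp only [orient_eq] at hX h2
  simp only [Complex.zero_re, Complex.zero_im, sub_zero] at hX h2
  have e1 : (1 - q.re) * (v.re * b.im - v.im * b.re) = -q.re * (a.re * b.im - a.im * b.re) := by
    linear_combination (-b.im) * hre + b.re * him
  have e2 : (1 - q.re) * (a.re * v.im - a.im * v.re) = (a.re * b.im - a.im * b.re) := by
    linear_combination (a.im) * hre - a.re * him
  rcases h2 with h2 | h2
  · have : 0 < -q.re * (a.re * b.im - a.im * b.re) := mul_pos (by linarith) hX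
    nlinarith
  · nlinarith

lemma vertex_angle (h : GaugeLike g m M) {N : ℕ} (hN : 3 ≤ N) (j n : ℕ) (hn : n + 1 < N) :
    ∑ i ∈ Finset.range n, (lg (vert g N (j + (i + 1))) (vert g N (j + (i + 1) + 1)) (vert g N j)).im
      = ((vert g N (j + (n + 1)) - vert g N j) / (vert g N (j + 1) - vert g N j)).arg := by
  have hne : ∀ i, 1 ≤ i → i < N → vert g N (j + i) - vert g N j ≠ 0 := fun i h1 h2 =>
    sub_ne_zero.2 (h.vert_ne hN j i h1 h2)
  have him : ∀ i, 1 ≤ i → i < N →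
      0 ≤ ((vert g N (j + i) - vert g N j) / (vert g N (j + 1) - vert g N j)).im := by
    intro i h1 h2
    rcases Nat.lt_or_ge 1 i with h3 | h3
    · apply im_div_nonneg
      have := h.vertex_orient hN j i h3 h2
      rwa [orient_cyc] at this
    · have : i = 1 := by omega
      subst this
      rw [div_self (hne 1 le_rfl h2)]; simp
  induction n with
  | zero =>
    simp [div_self (hne 1 le_rfl (by omega))]
  | succ n ih =>
    rw [Finset.sum_range_succ, ih (by omega), lg, Complex.log_im, add_comm]
    have hA := hne (n + 1) (by omega) (by omega)
    have hB := hne (n + 1 + 1) (by omega) (by omega)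
    have hC := hne 1 le_rfl (by omega)
    obtain ⟨v1, v2⟩ := h.vertex_edge hN j (n + 1) (by omega) (by omega)
    have e : (vert g N (j + (n + 1 + 1)) - vert g N j) / (vert g N (j + 1) - vert g N j) =
      ((vert g N (j + (n + 1) + 1) - vert g N j) / (vert g N (j + (n + 1)) - vert g N j)) *
        ((vert g N (j + (n + 1)) - vert g N j) / (vert g N (j + 1) - vert g N j)) := by
      rw [← add_assoc j (n + 1) 1]; field_simp
    have h3 := him (n + 1 + 1) (by omega) (by omega)
    rw [e] at h3 ⊢
    rw [arg_add_of_nonneg _ _ (im_div_nonneg v1) v2 (him (n + 1) (by omega) (by omega)) h3]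
    · exact div_ne_zero hB hA
    · exact div_ne_zero hA hC

end GaugeLike

lemma lg_near {a b z w : ℂ} {δ : ℝ} (hδ : 0 < δ) (hz : δ ≤ ‖a - z‖) (hw : ‖z - w‖ ≤ δ / 4)
    (hab : ‖b - a‖ ≤ δ / 4) : (lg a b z).im ≤ (lg a b w).im + ‖b - a‖ * 4 / δ ^ 2 * ‖z - w‖ := by
  have key : ∀ ζ ∈ segment ℝ w z, HasDerivWithinAt (lg a b) (1 / (a - ζ) - 1 / (b - ζ)) (segment ℝ w z) ζ
      ∧ ‖1 / (a - ζ) - 1 / (b - ζ)‖ ≤ ‖b - a‖ * 4 / δ ^ 2 := by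
    intro ζ hζ
    have hζz : ‖z - ζ‖ ≤ δ / 4 := by
      have h1 := (convex_closedBall z (δ / 4)).segment_subset (x := w) (y := z)
        (by rw [Metric.mem_closedBall, dist_eq_norm, norm_sub_rev]; exact hw)
        (by simp; linarith) hζ
      rw [Metric.mem_closedBall, dist_eq_norm, norm_sub_rev] at h1; exact h1
    have ha : 3 * δ / 4 ≤ ‖a - ζ‖ := by
      have h1 : ‖a - z‖ ≤ ‖a - ζ‖ + ‖z - ζ‖ := by
        have := norm_sub_le (a - ζ) (z - ζ)
        simpa using this
      linarith
    have hb : δ / 2 ≤ ‖b - ζ‖ := by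
      have h1 : ‖a - ζ‖ ≤ ‖b - ζ‖ + ‖b - a‖ := by
        have := norm_sub_le (b - ζ) (b - a)
        simpa using this
      linarith
    have ha0 : a - ζ ≠ 0 := by rw [← norm_pos_iff]; linarith
    have hb0 : b - ζ ≠ 0 := by rw [← norm_pos_iff]; linarith
    constructor
    · apply HasDerivAt.hasDerivWithinAt
      apply lg_hasDerivAt
      have e : (b - ζ) / (a - ζ) = 1 + (b - a) / (a - ζ) := by field_simp; ring
      rw [e, Complex.mem_slitPlane_iff]
      left
      have h1 : ‖(b - a) / (a - ζ)‖ < 1 := by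
        rw [norm_div, div_lt_one (by linarith)]; linarith
      have h2 := (abs_lt.1 (lt_of_le_of_lt (Complex.abs_re_le_norm _) h1)).1
      simp only [Complex.add_re, Complex.one_re]; linarith
    · have e : 1 / (a - ζ) - 1 / (b - ζ) = (b - a) / ((a - ζ) * (b - ζ)) := by field_simp; ring
      rw [e, norm_div, norm_mul, div_le_div_iff₀ (by positivity) (by positivity), mul_assoc]
      apply mul_le_mul_of_nonneg_left _ (norm_nonneg _)
      nlinarith
  have h1 := Convex.norm_image_sub_le_of_norm_hasDerivWithin_le (f := lg a b)
    (fun ζ hζ => (key ζ hζ).1) (fun ζ hζ => (key ζ hζ).2) (convex_segment w z)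
    (left_mem_segment ℝ w z) (right_mem_segment ℝ w z)
  have h2 := (Complex.abs_im_le_norm (lg a b z - lg a b w))
  have h3 := (abs_le.1 (h2.trans h1)).2
  simp only [Complex.sub_im] at h3; linarith

namespace GaugeLike
variable {g : ℂ → ℝ} {m M : ℝ}

lemma far_angle (h : GaugeLike g m M) {N : ℕ} (hN : 3 ≤ N) {δ η : ℝ} (hδ : 0 < δ) (hη : η ≤ δ / 4)
    (hs : ∀ k, ‖vert g N (k + 1) - vert g N k‖ ≤ η) {z : ℂ} (j : ℕ) (hz : ‖z - vert g N j‖ ≤ δ / 4) :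
    ∑ k ∈ Finset.range N with δ ≤ ‖vert g N k - z‖, (lg (vert g N k) (vert g N (k + 1)) z).im
      ≤ Real.pi + N * η * 4 / δ ^ 2 * ‖z - vert g N j‖ := by
  have h0η : 0 ≤ η := (norm_nonneg _).trans (hs 0)
  set w := vert g N j with hw
  have hper : ∀ k, vert g N (k + N) = vert g N k := fun k => vert_periodic (by omega) k
  have h1 : ∑ k ∈ Finset.range N with δ ≤ ‖vert g N k - z‖, (lg (vert g N k) (vert g N (k + 1)) z).im ≤
      ∑ k ∈ Finset.range N with δ ≤ ‖vert g N k - z‖, ((lg (vert g N k) (vert g N (k + 1)) w).im +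
        η * 4 / δ ^ 2 * ‖z - w‖) := by
    apply Finset.sum_le_sum
    intro k hk
    rw [Finset.mem_filter] at hk
    refine (lg_near hδ hk.2 hz ((hs k).trans hη)).trans ?_
    have := hs k
    gcongr
  refine h1.trans ?_
  rw [Finset.sum_add_distrib]
  have h2 : ∑ k ∈ Finset.range N with δ ≤ ‖vert g N k - z‖, (η * 4 / δ ^ 2 * ‖z - w‖) ≤
      N * η * 4 / δ ^ 2 * ‖z - w‖ := by
    rw [Finset.sum_const, nsmul_eq_mul]
    have : ((Finset.range N).filter (fun k => δ ≤ ‖vert g N k - z‖)).card ≤ N := by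
      simpa using Finset.card_filter_le (Finset.range N) (fun k => δ ≤ ‖vert g N k - z‖)
    have h3 : (((Finset.range N).filter (fun k => δ ≤ ‖vert g N k - z‖)).card : ℝ) ≤ N := by exact_mod_cast this
    calc _ ≤ (N : ℝ) * (η * 4 / δ ^ 2 * ‖z - w‖) := by gcongr
      _ = _ := by ring
  refine add_le_add ?_ h2
  rw [Finset.sum_filter]
  set f : ℕ → ℝ := fun k => if δ ≤ ‖vert g N k - z‖ then (lg (vert g N k) (vert g N (k + 1)) w).im else 0 with hf
  have hfper : ∀ k, f (k + N) = f k := by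
    intro k
    have e : k + N + 1 = k + 1 + N := by ring
    simp only [hf, hper, e]
  change ∑ k ∈ Finset.range N, f k ≤ Real.pi
  rw [← sum_range_shift f hfper j]
  obtain ⟨n, rfl⟩ : ∃ n, N = n + 2 := ⟨N - 2, by omega⟩
  rw [Finset.sum_range_succ, Finset.sum_range_succ']
  have hlast : f (j + (n + 1)) = 0 := by
    simp only [hf]
    rw [if_neg]
    push Not
    have h3 := hs (j + (n + 1))
    rw [show j + (n + 1) + 1 = j + (n + 2) by ring, hper j] at h3
    have : vert g (n + 2) (j + (n + 1)) - z = -(z - w) - (w - vert g (n + 2) (j + (n + 1))) := by ring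
    rw [this]
    calc _ ≤ ‖-(z - w)‖ + ‖w - vert g (n + 2) (j + (n + 1))‖ := norm_sub_le _ _
      _ ≤ δ / 4 + δ / 4 := by rw [norm_neg]; exact add_le_add hz (h3.trans hη)
      _ < δ := by linarith
  have hfirst : f (j + 0) = 0 := by
    simp only [hf]
    rw [if_neg]
    push Not
    rw [norm_sub_rev, add_zero]; linarith
  rw [hlast, hfirst, add_zero, add_zero]
  calc ∑ k ∈ Finset.range n, f (j + (k + 1)) ≤
      ∑ i ∈ Finset.range n, (lg (vert g (n + 2) (j + (i + 1))) (vert g (n + 2) (j + (i + 1) + 1)) w).im := by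
        apply Finset.sum_le_sum
        intro i hi
        rw [Finset.mem_range] at hi
        simp only [hf]
        split_ifs
        · exact le_rfl
        · rw [lg, Complex.log_im, Complex.arg_nonneg_iff]
          exact im_div_nonneg (h.vertex_edge hN j (i + 1) (by omega) (by omega)).1
    _ ≤ Real.pi := by
        rw [h.vertex_angle hN j n (by omega)]
        exact Complex.arg_le_pi _

end GaugeLike

namespace GaugeLike
variable {g : ℂ → ℝ} {m M : ℝ}

lemma convex_le (h : GaugeLike g m M) (r : ℝ) : Convex ℝ {z | g z ≤ r} := by
  intro x hx y hy a b ha hb hab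
  simp only [Set.mem_ofPred_eq] at *
  have := h.add (a • x) (b • y)
  rw [Complex.real_smul, Complex.real_smul, h.hom a ha, h.hom b hb] at this
  rw [Complex.real_smul, Complex.real_smul]
  have hb' : b = 1 - a := by linarith
  subst hb'
  nlinarith

lemma convex_lt (h : GaugeLike g m M) (r : ℝ) : Convex ℝ {z | g z < r} := by
  intro x hx y hy a b ha hb hab
  simp only [Set.mem_ofPred_eq] at *
  have := h.add (a • x) (b • y)
  rw [Complex.real_smul, Complex.real_smul, h.hom a ha, h.hom b hb] at this
  rw [Complex.real_smul, Complex.real_smul]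
  refine this.trans_lt ?_
  rcases ha.eq_or_lt with rfl | ha
  · have : b = 1 := by linarith
    subst this; linarith
  · have hb' : b = 1 - a := by linarith
    subst hb'
    nlinarith

lemma isOpen_lt (h : GaugeLike g m M) (r : ℝ) : IsOpen {z | g z < r} :=
  _root_.isOpen_lt h.cont continuous_const

lemma isCompact_le (h : GaugeLike g m M) (r : ℝ) : IsCompact {z | g z ≤ r} := by
  apply Metric.isCompact_of_isClosed_isBounded (isClosed_le h.cont continuous_const)
  rw [isBounded_iff_forall_norm_le]
  refine ⟨r / m, fun z hz => ?_⟩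
  rw [le_div_iff₀ h.hm]
  have := h.lower z
  have hz' : g z ≤ r := hz
  linarith

variable {B : Type*} [NormedAddCommGroup B] [NormedSpace ℂ B] [CompleteSpace B]

lemma edge_est (h : GaugeLike g m M) {F : ℂ → B} {R : ℝ} (hR : 1 < R)
    (hF : DifferentiableOn ℂ F {z | g z < R}) {z : ℂ} (hz : g z < R) {D ε : ℝ} (hD : 0 < D) (hε : 0 ≤ ε)
    {Φ : ℂ → B} (hΦ : ∀ w ∈ {z | g z < R}, HasDerivWithinAt Φ (dslope F z w) {z | g z < R} w)
    {a b : ℂ} (ha : g a ≤ 1) (hb : g b ≤ 1)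
    (hd : ∀ σ ∈ segment ℝ a b, D ≤ ‖σ - z‖) (hab : ‖b - a‖ < D)
    (hu : ∀ σ ∈ segment ℝ a b, ‖F a - F σ‖ ≤ ε) :
    ‖lg a b z • (F a - F z) - (Φ b - Φ a)‖ ≤ D⁻¹ * ε * ‖b - a‖ := by
  have haz : a - z ≠ 0 := by
    rw [← norm_pos_iff]; exact hD.trans_le (hd a (left_mem_segment ℝ a b))
  have key : ∀ σ ∈ segment ℝ a b,
      HasDerivWithinAt (fun σ => Complex.log ((σ - z) / (a - z)) • (F a - F z) - Φ σ)
        ((σ - z)⁻¹ • (F a - F σ)) (segment ℝ a b) σ ∧ ‖(σ - z)⁻¹ • (F a - F σ)‖ ≤ D⁻¹ * ε := by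
    intro σ hσ
    have hgσ : g σ < R := lt_of_le_of_lt ((h.convex_le 1).segment_subset ha hb hσ) hR
    have hσz : σ - z ≠ 0 := by
      rw [← norm_pos_iff]; exact hD.trans_le (hd σ hσ)
    have hσz' : σ ≠ z := sub_ne_zero.1 hσz
    constructor
    · apply HasDerivAt.hasDerivWithinAt
      have h1 : HasDerivAt Φ (dslope F z σ) σ :=
        (hΦ σ hgσ).hasDerivAt ((h.isOpen_lt R).mem_nhds hgσ)
      rw [dslope_of_ne _ hσz', slope_def_module] at h1
      have hslit : (σ - z) / (a - z) ∈ Complex.slitPlane := by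
        have e : (σ - z) / (a - z) = 1 + (σ - a) / (a - z) := by field_simp; ring
        rw [e, Complex.mem_slitPlane_iff]
        left
        have h4 : ‖σ - a‖ ≤ ‖b - a‖ := by
          rw [segment_eq_image'] at hσ
          obtain ⟨t, ht, rfl⟩ := hσ
          simp only [add_sub_cancel_left, norm_smul, Real.norm_eq_abs, abs_of_nonneg ht.1]
          nlinarith [ht.2, norm_nonneg (b - a)]
        have h5 := hd a (left_mem_segment ℝ a b)
        have h1 : ‖(σ - a) / (a - z)‖ < 1 := by
          rw [norm_div, div_lt_one (by linarith)]; linarith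
        have h2 := (abs_lt.1 (lt_of_le_of_lt (Complex.abs_re_le_norm _) h1)).1
        simp only [Complex.add_re, Complex.one_re]; linarith
      have h2 : HasDerivAt (fun σ => (σ - z) / (a - z)) (1 / (a - z)) σ :=
        ((hasDerivAt_id σ).sub_const z).div_const _
      have h3 := ((h2.clog hslit).smul_const (F a - F z)).sub h1
      convert! h3 using 1
      have : 1 / (a - z) / ((σ - z) / (a - z)) = (σ - z)⁻¹ := by field_simp
      rw [this, ← smul_sub]
      congr 1; abel
    · rw [norm_smul, norm_inv]
      have := hd σ hσ
      have := hu σ hσ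
      gcongr
  have h1 := Convex.norm_image_sub_le_of_norm_hasDerivWithin_le
    (fun ζ hζ => (key ζ hζ).1) (fun ζ hζ => (key ζ hζ).2) (convex_segment a b)
    (left_mem_segment ℝ a b) (right_mem_segment ℝ a b)
  have e : (Complex.log ((b - z) / (a - z)) • (F a - F z) - Φ b) -
    (Complex.log ((a - z) / (a - z)) • (F a - F z) - Φ a) = lg a b z • (F a - F z) - (Φ b - Φ a) := by
    rw [div_self haz, Complex.log_one, lg, zero_smul]; abel
  rw [e] at h1
  exact h1

/-- length constant -/
noncomputable def Lc (m M : ℝ) : ℝ := (1 / m + M / m ^ 2) * (2 * Real.pi)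

lemma Lc_pos (h : GaugeLike g m M) : 0 < Lc m M := by
  have := h.hm; have := h.hM; have := Real.pi_pos
  unfold Lc; positivity

lemma bdry_vert (h : GaugeLike g m M) {N : ℕ} (hN : 0 < N) {θ : ℝ} {k : ℕ}
    (hθ : |θ - k * (2 * Real.pi / N)| ≤ 2 * Real.pi / N) :
    ‖bdry g θ - vert g N k‖ ≤ Lc m M / N := by
  rw [vert]
  refine (h.bdry_lip _ _).trans ?_
  have := h.hm; have := h.hM
  calc _ ≤ (1 / m + M / m ^ 2) * (2 * Real.pi / N) := by gcongr
    _ = _ := by rw [Lc]; ring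

lemma vert_step (h : GaugeLike g m M) {N : ℕ} (hN : 0 < N) (k : ℕ) :
    ‖vert g N (k + 1) - vert g N k‖ ≤ Lc m M / N := by
  rw [vert]
  apply h.bdry_vert hN
  push_cast
  have : ((k : ℝ) + 1) * (2 * Real.pi / N) - k * (2 * Real.pi / N) = 2 * Real.pi / N := by ring
  rw [this, abs_of_pos]
  have := Real.pi_pos
  positivity

lemma unif (h : GaugeLike g m M) {F : ℂ → B} (hF : ContinuousOn F {z | g z ≤ 1}) {ε : ℝ} (hε : 0 < ε) :
    ∃ δ > 0, ∀ x, g x ≤ 1 → ∀ y, g y ≤ 1 → ‖x - y‖ < δ → ‖F x - F y‖ ≤ ε := by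
  have := (h.isCompact_le 1).uniformContinuousOn_of_continuous hF
  rw [Metric.uniformContinuousOn_iff] at this
  obtain ⟨δ, hδ, H⟩ := this ε hε
  refine ⟨δ, hδ, fun x hx y hy hxy => ?_⟩
  rw [← dist_eq_norm] at hxy ⊢
  exact (H x hx y hy hxy).le

lemma eventually_small (h : GaugeLike g m M) {r : ℝ} (hr : 0 < r) :
    ∃ N0 : ℕ, ∀ N ≥ N0, 3 ≤ N ∧ Lc m M / N < r := by
  obtain ⟨n, hn⟩ := exists_nat_gt (Lc m M / r)
  refine ⟨n + 3, fun N hN => ⟨by omega, ?_⟩⟩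
  have hN3 : 0 < N := by omega
  have hN' : (0 : ℝ) < N := by exact_mod_cast hN3
  have : (n : ℝ) ≤ N := by exact_mod_cast (by omega : n ≤ N)
  rw [div_lt_iff₀ hN']
  rw [div_lt_iff₀ hr] at hn
  nlinarith

lemma riemann (h : GaugeLike g m M) {F : ℂ → B} {R : ℝ} (hR : 1 < R)
    (hF : DifferentiableOn ℂ F {z | g z < R}) {c ε : ℝ} (hc : c < 1) (hε : 0 < ε) :
    ∃ N0 : ℕ, ∀ N ≥ N0, 3 ≤ N ∧ (∀ z, g z ≤ c → ∀ k, 0 < orient z (vert g N k) (vert g N (k + 1))) ∧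
      (∀ z, g z ≤ c → ∑ k ∈ Finset.range N, lg (vert g N k) (vert g N (k + 1)) z = 2 * Real.pi * Complex.I) ∧
      (∀ z, g z ≤ c → ‖∑ k ∈ Finset.range N,
        (lg (vert g N k) (vert g N (k + 1)) z / (2 * Real.pi * Complex.I)) • F (vert g N k) - F z‖ ≤ ε) := by
  set L := Lc m M with hL
  have hLpos : 0 < L := h.Lc_pos
  have hM := h.hM
  set D := (1 - c) / (2 * M) with hD
  have hDpos : 0 < D := div_pos (by linarith) (by linarith)
  obtain ⟨δ, hδ, hu⟩ := h.unif (hF.continuousOn.mono (fun z (hz : g z ≤ 1) => lt_of_le_of_lt hz hR))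
    (show 0 < ε * D / L by positivity)
  obtain ⟨N0, hN0⟩ := h.eventually_small (show 0 < min D δ by positivity)
  refine ⟨N0, fun N hN => ?_⟩
  obtain ⟨hN3, hNs⟩ := hN0 N hN
  have hNpos : 0 < N := by omega
  have hNpos' : (0 : ℝ) < N := by exact_mod_cast hNpos
  have hstep : ∀ k, ‖vert g N (k + 1) - vert g N k‖ ≤ L / N := h.vert_step hNpos
  have hsD : ∀ k, ‖vert g N (k + 1) - vert g N k‖ < D := fun k =>
    (hstep k).trans_lt (hNs.trans_le (min_le_left _ _))
  have hsδ : ∀ k, ‖vert g N (k + 1) - vert g N k‖ < δ := fun k =>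
    (hstep k).trans_lt (hNs.trans_le (min_le_right _ _))
  have hMD : M * D = (1 - c) / 2 := by rw [hD]; field_simp
  have hs : ∀ k, M * ‖vert g N k - vert g N (k + 1)‖ < 1 - c := by
    intro k
    rw [norm_sub_rev]
    have := mul_lt_mul_of_pos_left (hsD k) hM
    linarith
  refine ⟨hN3, fun z hz k => h.orient_pos (h.g_vert _ _) (h.g_vert _ _) (h.orient_vert_succ hN3 k) hc (hs k) hz,
    fun z hz => h.sum_lg hN3 hc hs hz, fun z hz => ?_⟩
  have hzR : g z < R := by linarith
  have hdsl : DifferentiableOn ℂ (dslope F z) {z | g z < R} :=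
    (Complex.differentiableOn_dslope ((h.isOpen_lt R).mem_nhds hzR)).2 hF
  obtain ⟨Φ, hΦ⟩ := (h.convex_lt R).exists_forall_hasDerivWithinAt hdsl
  have hper : vert g N N = vert g N 0 := by
    have := vert_periodic (g := g) (N := N) (by omega) 0
    simpa using this
  have hedge : ∀ k ∈ Finset.range N, ‖lg (vert g N k) (vert g N (k + 1)) z • (F (vert g N k) - F z)
      - (Φ (vert g N (k + 1)) - Φ (vert g N k))‖ ≤ D⁻¹ * (ε * D / L) * (L / N) := by
    intro k _
    have hseg : ∀ σ ∈ segment ℝ (vert g N k) (vert g N (k + 1)),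
        ‖vert g N k - σ‖ ≤ ‖vert g N (k + 1) - vert g N k‖ := by
      intro σ hσ
      rw [segment_eq_image'] at hσ
      obtain ⟨t, ht, rfl⟩ := hσ
      simp only [sub_add_cancel_left, norm_neg, norm_smul, Real.norm_eq_abs, abs_of_nonneg ht.1]
      nlinarith [ht.2, norm_nonneg (vert g N (k + 1) - vert g N k)]
    refine (h.edge_est hR hF hzR hDpos (show 0 ≤ ε * D / L by positivity) hΦ (h.g_vert N k).le
      (h.g_vert N (k + 1)).le ?_ (hsD k) ?_).trans ?_
    · intro σ hσ
      have h1 := h.sub_le (vert g N k) σ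
      have h2 := h.sub_le σ z
      rw [h.g_vert] at h1
      have h3 := (hseg σ hσ).trans_lt (hsD k)
      have h4 := mul_lt_mul_of_pos_left h3 hM
      have h5 : M * D ≤ M * ‖σ - z‖ := by rw [hMD] at *; linarith
      exact le_of_mul_le_mul_left h5 hM
    · intro σ hσ
      exact hu _ (h.g_vert N k).le _ ((h.convex_le 1).segment_subset (h.g_vert N k).le
        (h.g_vert N (k + 1)).le hσ) ((hseg σ hσ).trans_lt (hsδ k))
    · have := hstep k
      gcongr
  have hsum := (norm_sum_le _ _).trans (Finset.sum_le_sum hedge)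
  rw [Finset.sum_sub_distrib, Finset.sum_range_sub (fun k => Φ (vert g N k)), hper, sub_self, sub_zero,
    Finset.sum_const, Finset.card_range, nsmul_eq_mul] at hsum
  have e1 : (N : ℝ) * (D⁻¹ * (ε * D / L) * (L / N)) = ε := by field_simp
  rw [e1] at hsum
  have hpi : (2 * Real.pi * Complex.I : ℂ) ≠ 0 := by simp [Real.pi_ne_zero]
  have e2 : ∑ k ∈ Finset.range N, (lg (vert g N k) (vert g N (k + 1)) z / (2 * Real.pi * Complex.I)) • F (vert g N k) - F z
      = (2 * Real.pi * Complex.I : ℂ)⁻¹ • ∑ k ∈ Finset.range N, lg (vert g N k) (vert g N (k + 1)) z • (F (vert g N k) - F z) := by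
    simp_rw [smul_sub]
    rw [Finset.sum_sub_distrib, ← Finset.sum_smul, h.sum_lg hN3 hc hs hz, smul_sub, smul_smul,
      inv_mul_cancel₀ hpi, one_smul, Finset.smul_sum]
    congr 1
    apply Finset.sum_congr rfl
    intro k _
    rw [smul_smul, div_eq_inv_mul]
  rw [e2, norm_smul, norm_inv]
  have h2pi : 1 ≤ ‖(2 * Real.pi * Complex.I : ℂ)‖ := by
    simp [abs_of_pos Real.pi_pos]
    linarith [Real.pi_gt_three]
  calc _ ≤ 1 * ε := by
        gcongr
        exact inv_le_one_of_one_le₀ h2pi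
    _ = ε := one_mul _

lemma exists_near_vert (h : GaugeLike g m M) {N : ℕ} (hN : 0 < N) {c : ℝ} (hc0 : 0 < c) (hc : c < 1) {z : ℂ}
    (hz : g z = c) : ∃ j, ‖z - vert g N j‖ ≤ (1 - c) / m + Lc m M / N := by
  have hz0 : z ≠ 0 := by
    rintro rfl
    have := h.upper 0
    simp at this; linarith
  have hN' : (0 : ℝ) < N := by exact_mod_cast hN
  have hp := Real.pi_pos
  obtain ⟨θ, hθ0, hθ⟩ : ∃ θ : ℝ, 0 ≤ θ ∧ z = (‖z‖ : ℂ) * Complex.exp (θ * Complex.I) := by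
    rcases le_or_gt 0 z.arg with h1 | h1
    · exact ⟨z.arg, h1, (Complex.norm_mul_exp_arg_mul_I z).symm⟩
    · refine ⟨z.arg + 2 * Real.pi, by linarith [Complex.neg_pi_lt_arg z], ?_⟩
      push_cast
      rw [add_mul, Complex.exp_periodic]
      exact (Complex.norm_mul_exp_arg_mul_I z).symm
  have hgz : c = ‖z‖ * g (Complex.exp (θ * Complex.I)) := by
    rw [← hz, ← h.hom _ (norm_nonneg z), ← hθ]
  have hzb : z = (c : ℂ) * bdry g θ := by
    have := (h.exp_pos θ).ne'
    have h2 : (g (Complex.exp (θ * Complex.I)) : ℂ) ≠ 0 := by exact_mod_cast this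
    rw [hgz, bdry]
    push_cast
    field_simp
    exact hθ
  have hstep : 0 < 2 * Real.pi / N := by positivity
  refine ⟨⌊θ / (2 * Real.pi / N)⌋₊, ?_⟩
  have h1 := Nat.floor_le (div_nonneg hθ0 hstep.le)
  have h2 := Nat.lt_floor_add_one (θ / (2 * Real.pi / N))
  rw [le_div_iff₀ hstep] at h1
  rw [div_lt_iff₀ hstep] at h2
  have h3 : ‖bdry g θ - vert g N ⌊θ / (2 * Real.pi / N)⌋₊‖ ≤ Lc m M / N := by
    apply h.bdry_vert hN
    rw [abs_le]
    constructor <;> nlinarith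
  have h4 : ‖z - bdry g θ‖ ≤ (1 - c) / m := by
    have : z - bdry g θ = ((c - 1 : ℝ) : ℂ) * bdry g θ := by rw [hzb]; push_cast; ring
    rw [this, norm_mul, Complex.norm_real, Real.norm_eq_abs, abs_of_neg (by linarith)]
    have := h.norm_bdry_le θ
    have hm := h.hm
    calc -(c - 1) * ‖bdry g θ‖ ≤ -(c - 1) * (1 / m) := by gcongr; linarith
      _ = _ := by ring
  calc ‖z - vert g N ⌊θ / (2 * Real.pi / N)⌋₊‖ = ‖(z - bdry g θ) + (bdry g θ - vert g N ⌊θ / (2 * Real.pi / N)⌋₊)‖ := by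
        congr 1; ring
    _ ≤ _ := (norm_add_le _ _).trans (add_le_add h4 h3)

end GaugeLike

open Classical in
/-- near / far estimate, abstractly. -/
lemma near_far {B : Type*} [NormedAddCommGroup B] [NormedSpace ℝ B] {ι : Type*} (s : Finset ι) (P : ι → Prop)
    (w : ι → ℝ) (hw : ∀ i ∈ s, 0 ≤ w i) (hsum : ∑ i ∈ s, w i = 2) (f : ι → B) (f0 : B) {b ε τ : ℝ}
    (hb : ∀ i ∈ s, ‖f i‖ ≤ b) (hb0 : ‖f0‖ ≤ b) (hε : 0 ≤ ε) (hτ : 0 ≤ τ)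
    (hnear : ∀ i ∈ s, ¬ P i → ‖f i - f0‖ ≤ ε) (hfar : ∑ i ∈ s with P i, w i ≤ 1 + τ) :
    ‖∑ i ∈ s, w i • f i - f0‖ ≤ b + 2 * τ * b + 2 * ε := by
  have hbn : 0 ≤ b := (norm_nonneg _).trans hb0
  set J := ∑ i ∈ s with P i, w i with hJ
  set J' := ∑ i ∈ s with ¬ P i, w i with hJ'
  have hJJ : J + J' = 2 := by rw [← hsum, hJ, hJ', Finset.sum_filter_add_sum_filter_not]
  have hJ0 : 0 ≤ J := Finset.sum_nonneg (fun i hi => hw i (Finset.mem_of_mem_filter i hi))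
  have hJ0' : 0 ≤ J' := Finset.sum_nonneg (fun i hi => hw i (Finset.mem_of_mem_filter i hi))
  have e : ∑ i ∈ s, w i • f i - f0 = (∑ i ∈ s with P i, w i • f i + (1 - J) • f0) +
      ∑ i ∈ s with ¬ P i, w i • (f i - f0) := by
    rw [← Finset.sum_filter_add_sum_filter_not s P]
    simp_rw [smul_sub]
    rw [Finset.sum_sub_distrib, ← Finset.sum_smul, ← hJ']
    have : J' = 2 - J := by linarith
    rw [this]
    module
  rw [e]
  have h1 : ‖∑ i ∈ s with P i, w i • f i‖ ≤ J * b := by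
    refine (norm_sum_le _ _).trans ?_
    rw [hJ, Finset.sum_mul]
    apply Finset.sum_le_sum
    intro i hi
    have his := Finset.mem_of_mem_filter i hi
    rw [norm_smul, Real.norm_eq_abs, abs_of_nonneg (hw i his)]
    exact mul_le_mul_of_nonneg_left (hb i his) (hw i his)
  have h2 : ‖∑ i ∈ s with ¬ P i, w i • (f i - f0)‖ ≤ J' * ε := by
    refine (norm_sum_le _ _).trans ?_
    rw [hJ', Finset.sum_mul]
    apply Finset.sum_le_sum
    intro i hi
    have his := Finset.mem_of_mem_filter i hi
    rw [norm_smul, Real.norm_eq_abs, abs_of_nonneg (hw i his)]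
    exact mul_le_mul_of_nonneg_left (hnear i his (Finset.mem_filter.1 hi).2) (hw i his)
  have h3 : ‖(1 - J) • f0‖ ≤ |1 - J| * b := by
    rw [norm_smul, Real.norm_eq_abs]
    exact mul_le_mul_of_nonneg_left hb0 (abs_nonneg _)
  have h4 : J * b + |1 - J| * b ≤ b + 2 * τ * b := by
    rcases abs_cases (1 - J) with ⟨h5, _⟩ | ⟨h5, _⟩
    · rw [h5]; nlinarith [mul_nonneg hτ hbn]
    · rw [h5]; nlinarith
  have h5 : J' * ε ≤ 2 * ε := by gcongr; linarith
  have h6 := norm_add_le (∑ i ∈ s with P i, w i • f i + (1 - J) • f0) (∑ i ∈ s with ¬ P i, w i • (f i - f0))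
  have h7 := norm_add_le (∑ i ∈ s with P i, w i • f i) ((1 - J) • f0)
  linarith

namespace GaugeLike
variable {g : ℂ → ℝ} {m M : ℝ}
variable {B : Type*} [NormedAddCommGroup B] [NormedSpace ℂ B] [CompleteSpace B]

/-- scalar Cauchy weights -/
noncomputable def el (g : ℂ → ℝ) (N k : ℕ) (z : ℂ) : ℂ :=
  lg (vert g N k) (vert g N (k + 1)) z / (2 * Real.pi * Complex.I)

lemma conj_el (g : ℂ → ℝ) (N k : ℕ) (z : ℂ) : starRingEnd ℂ (el g N k z) =
    (((lg (vert g N k) (vert g N (k + 1)) z).im / Real.pi : ℝ) : ℂ) - el g N k z := by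
  have hp : (Real.pi : ℂ) ≠ 0 := by exact_mod_cast Real.pi_ne_zero
  have := Real.pi_ne_zero
  rw [el]
  set w := lg (vert g N k) (vert g N (k + 1)) z
  have e : w / (2 * Real.pi * Complex.I) = ((w.im / (2 * Real.pi) : ℝ) : ℂ) - ((w.re / (2 * Real.pi) : ℝ) : ℂ) * Complex.I := by
    rw [div_eq_iff (by simp [Real.pi_ne_zero])]
    apply Complex.ext
    · simp [-Complex.ofReal_div]
    · simp [-Complex.ofReal_div]
  rw [e]
  apply Complex.ext
  · simp [-Complex.ofReal_div]; field_simp; ring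
  · simp [-Complex.ofReal_div]

lemma poly_data (h : GaugeLike g m M) {F : ℂ → B} {R : ℝ} (hR : 1 < R)
    (hF : DifferentiableOn ℂ F {z | g z < R}) {b : ℝ} (hb : ∀ z, g z ≤ 1 → ‖F z‖ ≤ b)
    {c0 ε : ℝ} (hc0 : c0 < 1) (hε : 0 < ε) :
    ∃ (N : ℕ) (c : ℝ), 3 ≤ N ∧ 0 < c ∧ c0 < c ∧ c < 1 ∧
      (∀ z, g z ≤ c → ∀ k, 0 < orient z (vert g N k) (vert g N (k + 1))) ∧
      (∀ z, g z ≤ c → ∑ k ∈ Finset.range N, el g N k z = 1) ∧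
      (∀ z, g z ≤ c → ‖∑ k ∈ Finset.range N, el g N k z • F (vert g N k) - F z‖ ≤ ε) ∧
      (∀ z, g z = c → ‖∑ k ∈ Finset.range N, starRingEnd ℂ (el g N k z) • F (vert g N k)‖ ≤ b + ε) := by
  have hm := h.hm
  have hpi := Real.pi_pos
  set L := Lc m M with hL
  have hLpos : 0 < L := h.Lc_pos
  have hb0 : 0 ≤ b := (norm_nonneg _).trans (hb 0 (by have := h.upper 0; simp at this; linarith))
  have hcont : ContinuousOn F {z | g z ≤ 1} :=
    hF.continuousOn.mono (fun z (hz : g z ≤ 1) => lt_of_le_of_lt hz hR)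
  obtain ⟨δ, hδ, hu⟩ := h.unif hcont (show 0 < ε / 8 by positivity)
  set τ := ε / (8 * (b + 1)) with hτ
  have hτpos : 0 < τ := by positivity
  set κ := min (δ / 4) (τ * δ ^ 2 / (4 * L)) with hκ
  have hκpos : 0 < κ := by positivity
  set c := max (max c0 0 / 2 + 1 / 2) (1 - m * κ / 2) with hc
  have hc1 : c < 1 := by
    rw [hc]
    apply max_lt
    · have : max c0 0 < 1 := max_lt hc0 one_pos
      linarith
    · have : 0 < m * κ := by positivity
      linarith
  have hcc : max c0 0 / 2 + 1 / 2 ≤ c := le_max_left _ _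
  have hcκ : 1 - m * κ / 2 ≤ c := le_max_right _ _
  have hm0 : 0 ≤ max c0 0 := le_max_right _ _
  have hm1 : c0 ≤ max c0 0 := le_max_left _ _
  have hm2 : max c0 0 < 1 := max_lt hc0 one_pos
  have hcpos : 0 < c := by linarith
  obtain ⟨N1, hN1⟩ := h.riemann hR hF hc1 (show 0 < ε / 4 by positivity)
  obtain ⟨N2, hN2⟩ := h.eventually_small (show 0 < κ / 2 by positivity)
  set N := max N1 N2 with hN
  obtain ⟨hN3, hor, hsum, hrie⟩ := hN1 N (le_max_left _ _)
  obtain ⟨-, hNs⟩ := hN2 N (le_max_right _ _)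
  have hNpos : 0 < N := by omega
  have hNpos' : (0 : ℝ) < N := by exact_mod_cast hNpos
  have h2pi : (2 * Real.pi * Complex.I : ℂ) ≠ 0 := by simp [Real.pi_ne_zero]
  refine ⟨N, c, hN3, hcpos, by linarith, hc1, hor, ?_, ?_, ?_⟩
  · intro z hz
    simp only [el]
    rw [← Finset.sum_div, hsum z hz, div_self h2pi]
  · intro z hz
    exact (hrie z hz).trans (by linarith)
  · intro z hz
    have hz1 : g z ≤ 1 := by linarith
    obtain ⟨j, hj⟩ := h.exists_near_vert hNpos hcpos hc1 hz
    have hjκ : ‖z - vert g N j‖ ≤ κ := by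
      have : (1 - c) / m ≤ κ / 2 := by
        rw [div_le_iff₀ hm]; linarith
      linarith
    have hκ1 : κ ≤ δ / 4 := min_le_left _ _
    have hκ2 : κ ≤ τ * δ ^ 2 / (4 * L) := min_le_right _ _
    have hfar := h.far_angle hN3 hδ (show L / N ≤ δ / 4 by linarith) (h.vert_step hNpos) j (hjκ.trans hκ1)
    have hfar2 : (N : ℝ) * (L / N) * 4 / δ ^ 2 * ‖z - vert g N j‖ ≤ τ := by
      calc _ = 4 * L / δ ^ 2 * ‖z - vert g N j‖ := by field_simp
        _ ≤ 4 * L / δ ^ 2 * (τ * δ ^ 2 / (4 * L)) := by gcongr; linarith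
        _ = τ := by field_simp
    set w : ℕ → ℝ := fun k => (lg (vert g N k) (vert g N (k + 1)) z).im / Real.pi with hw
    have hw0 : ∀ k, 0 ≤ w k := by
      intro k
      apply div_nonneg _ hpi.le
      rw [lg, Complex.log_im]
      exact Complex.arg_nonneg_iff.2 (im_div_pos (hor z hz.le k)).le
    have hw2 : ∑ k ∈ Finset.range N, w k = 2 := by
      have := congrArg Complex.im (hsum z hz.le)
      simp only [hw]
      rw [← Finset.sum_div, ← Complex.im_sum, this]
      simp
    classical
    have key := near_far (Finset.range N) (fun k => δ ≤ ‖vert g N k - z‖) w (fun k _ => hw0 k) hw2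
      (fun k => F (vert g N k)) (F z) (b := b) (ε := ε / 8) (τ := τ) (fun k _ => hb _ (h.g_vert N k).le)
      (hb z hz1) (by positivity) hτpos.le
      (fun k _ hk => hu _ (h.g_vert N k).le _ hz1 (not_le.1 hk)) (by
        simp only [hw]
        rw [← Finset.sum_div, div_le_iff₀ hpi]
        have h1 : τ ≤ τ * Real.pi := by nlinarith [Real.pi_gt_three]
        convert hfar.trans (show _ ≤ (1 + τ) * Real.pi by linarith) using 2)
    have e : ∑ k ∈ Finset.range N, starRingEnd ℂ (el g N k z) • F (vert g N k) =
        (∑ k ∈ Finset.range N, w k • F (vert g N k) - F z) -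
        (∑ k ∈ Finset.range N, el g N k z • F (vert g N k) - F z) := by
      rw [sub_sub_sub_cancel_right, ← Finset.sum_sub_distrib]
      apply Finset.sum_congr rfl
      intro k _
      rw [conj_el, sub_smul]
      rfl
    rw [e]
    have h1 := (norm_sub_le _ _).trans (add_le_add key (hrie z hz.le))
    refine h1.trans ?_
    have : τ * b ≤ ε / 8 := by
      rw [hτ, div_mul_eq_mul_div, div_le_div_iff₀ (by positivity) (by positivity)]
      nlinarith
    linarith

end GaugeLike

section Ops
variable {H : Type*} [NormedAddCommGroup H] [InnerProductSpace ℂ H] [CompleteSpace H]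

lemma norm_sum_pos {κ : Type*} (s : Finset κ) (Mk C : κ → H →L[ℂ] H) (hM : ∀ k ∈ s, 0 ≤ Mk k)
    (hsum : ∑ k ∈ s, Mk k = 2) {b : ℝ} (hb0 : 0 ≤ b) (hb : ∀ k ∈ s, ‖C k‖ ≤ b)
    (hc : ∀ k ∈ s, Commute (Mk k) (C k)) : ‖∑ k ∈ s, C k * Mk k‖ ≤ 2 * b := by
  set Q : κ → H →L[ℂ] H := fun k => CFC.sqrt (Mk k) with hQ
  have hQQ : ∀ k ∈ s, Q k * Q k = Mk k := fun k hk => CFC.sqrt_mul_sqrt_self _ (hM k hk)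
  have hQc : ∀ k ∈ s, Commute (Q k) (C k) := fun k hk => Commute.cfcₙ_nnreal (hc k hk) _
  have hQs : ∀ k, star (Q k) = Q k := fun k => (IsSelfAdjoint.of_nonneg (CFC.sqrt_nonneg (Mk k))).star_eq
  have hQi : ∀ k x y, inner ℂ (Q k x) y = inner ℂ x (Q k y) := by
    intro k x y
    have h1 := ContinuousLinearMap.adjoint_inner_left (Q k) y x
    rw [← ContinuousLinearMap.star_eq_adjoint, hQs] at h1
    exact h1
  have hn : ∀ x : H, ‖x‖ = 1 → ∑ k ∈ s, ‖Q k x‖ ^ 2 = 2 := by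
    intro x hx
    have h1 : ∀ k ∈ s, ‖Q k x‖ ^ 2 = (inner ℂ x (Mk k x)).re := by
      intro k hk
      rw [← hQQ k hk, mul_apply_eq_comp, ← hQi]
      exact (inner_self_eq_norm_sq (𝕜 := ℂ) (Q k x)).symm
    rw [Finset.sum_congr rfl h1, ← Complex.re_sum, ← inner_sum]
    have : ∑ k ∈ s, (Mk k) x = (2 : ℂ) • x := by
      rw [← _root_.sum_apply, hsum, two_smul]
      rw [← one_add_one_eq_two, _root_.add_apply]; simp
    rw [this, inner_smul_right, inner_self_eq_norm_sq_to_K, hx]; simp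
  apply ContinuousLinearMap.opNorm_le_of_re_inner_le (by positivity)
  intro x y hx hy
  rw [_root_.sum_apply, sum_inner]
  have h2 : ∀ k ∈ s, RCLike.re (inner ℂ ((C k * Mk k) x) y) ≤ b * (‖Q k x‖ * ‖Q k y‖) := by
    intro k hk
    have e : C k * Mk k = Q k * C k * Q k := by
      rw [(hQc k hk).eq, mul_assoc, hQQ k hk]
    rw [e, mul_apply_eq_comp, mul_apply_eq_comp, hQi]
    refine (re_inner_le_norm _ _).trans ?_
    have := ((C k).le_opNorm (Q k x)).trans (mul_le_mul_of_nonneg_right (hb k hk) (norm_nonneg _))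
    calc _ ≤ b * ‖Q k x‖ * ‖Q k y‖ := by gcongr
      _ = _ := by ring
  rw [map_sum]
  refine (Finset.sum_le_sum h2).trans ?_
  rw [← Finset.mul_sum]
  have h3 := Real.sum_mul_le_sqrt_mul_sqrt s (fun k => ‖Q k x‖) (fun k => ‖Q k y‖)
  rw [hn x hx, hn y hy, Real.mul_self_sqrt (by norm_num)] at h3
  nlinarith

end Ops

lemma gauge_exists {E V : Set ℂ} (hE : IsCompact E) (hc : Convex ℝ E) (h0 : (0 : ℂ) ∈ E) (hV : IsOpen V) (hEV : E ⊆ V) :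
    ∃ (g : ℂ → ℝ) (m M R c0 : ℝ), GaugeLike g m M ∧ 1 < R ∧ {z | g z < R} ⊆ V ∧ c0 < 1 ∧ ∀ z ∈ E, g z ≤ c0 := by
  obtain ⟨ρ', hρ', hsub⟩ := hE.exists_cthickening_subset_open hV hEV
  set ρ := ρ' / 2 with hρ
  have hρpos : 0 < ρ := by positivity
  set Ω := Metric.thickening ρ E with hΩ
  have hopen : IsOpen Ω := Metric.isOpen_thickening
  have hconv : Convex ℝ Ω := hc.thickening ρ
  have hEΩ : E ⊆ Ω := Metric.self_subset_thickening hρpos E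
  have h0Ω : (0 : ℂ) ∈ Ω := hEΩ h0
  have hball : Metric.ball (0 : ℂ) ρ ⊆ Ω := Metric.ball_subset_thickening h0 ρ
  have hbdd : Bornology.IsBounded Ω := hE.isBounded.thickening
  obtain ⟨r, hr, hΩr⟩ := hbdd.subset_closedBall_lt 0 0
  have habs : Absorbent ℝ Ω := absorbent_nhds_zero (hopen.mem_nhds h0Ω)
  have hG : GaugeLike (gauge Ω) (1 / r) (1 / ρ) := by
    refine ⟨by positivity, by positivity, ?_, ?_, ?_, ?_⟩
    · intro t ht z
      have := gauge_smul_of_nonneg (s := Ω) ht z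
      rwa [Complex.real_smul, smul_eq_mul] at this
    · intro z w; exact gauge_add_le hconv habs z w
    · intro z
      have := le_gauge_of_subset_closedBall (x := z) habs hr.le hΩr
      rw [div_eq_inv_mul] at this
      simpa using this
    · intro z
      have := mul_gauge_le_norm (x := z) hball
      rw [one_div, inv_mul_eq_div, le_div_iff₀ hρpos]; linarith
  have hlt : ∀ z, gauge Ω z < 1 ↔ z ∈ Ω := by
    intro z
    have := setOfPred_gauge_lt_one_eq_self_of_isOpen hconv h0Ω hopen
    constructor
    · intro h; rw [← this]; exact h
    · intro h; rw [← this] at h; exact h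
  obtain ⟨x, hx, hmax⟩ := hE.exists_isMaxOn ⟨0, h0⟩ hG.cont.continuousOn
  refine ⟨gauge Ω, 1 / r, 1 / ρ, 1 + ρ / r, gauge Ω x, hG, by have : 0 < ρ / r := by positivity
                                                              linarith, ?_, (hlt x).2 (hEΩ hx), fun z hz => hmax hz⟩
  intro z hz
  apply hsub
  have hRpos : 0 < 1 + ρ / r := by positivity
  have hz' : gauge Ω z < 1 + ρ / r := hz
  set R := 1 + ρ / r with hR
  have h1 : gauge Ω (((R⁻¹ : ℝ) : ℂ) * z) < 1 := by
    rw [hG.hom _ (by positivity), inv_mul_lt_iff₀ hRpos, mul_one]; exact hz'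
  have h2 := (hlt _).1 h1
  set w := ((R⁻¹ : ℝ) : ℂ) * z with hw
  have h3 : dist z w ≤ ρ := by
    have hzw : z = (R : ℂ) * w := by
      rw [hw]; push_cast
      have : (R : ℂ) ≠ 0 := by exact_mod_cast hRpos.ne'
      field_simp
    have : z - w = ((ρ / r : ℝ) : ℂ) * w := by
      nth_rewrite 1 [hzw]
      rw [hR]; push_cast; ring
    rw [dist_eq_norm, this, norm_mul, Complex.norm_real, Real.norm_eq_abs, abs_of_pos (by positivity)]
    have hwr : ‖w‖ ≤ r := by simpa using hΩr h2
    calc ρ / r * ‖w‖ ≤ ρ / r * r := by gcongr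
      _ = ρ := by field_simp
  rw [hΩ, Metric.mem_thickening_iff] at h2
  obtain ⟨e, he, hwe⟩ := h2
  apply Metric.mem_cthickening_of_dist_le z e ρ' E he
  have := dist_triangle z w e
  linarith

section Pos
variable {H : Type*} [NormedAddCommGroup H] [InnerProductSpace ℂ H]

lemma im_lg_nonneg {ι : Type*} [Fintype ι] [DecidableEq ι] (P : ι → H →L[ℂ] H) (lam : ι → ℂ)
    (hPP : ∀ i j, P i * P j = if i = j then P i else 0) (hP1 : ∑ i, P i = 1) {E : Set ℂ}
    (hlam : ∀ i, lam i ∈ E)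
    (hW : ∀ (u : ℂ) (c : ℝ), (∀ z ∈ E, (u * z).re ≤ c) →
      ∀ x : H, (u * inner ℂ x (∑ i, lam i • P i x)).re ≤ c * ‖x‖ ^ 2)
    {a b : ℂ} (hab : ∀ z ∈ E, 0 < orient z a b) (x : H) :
    0 ≤ (∑ i, lg a b (lam i) * inner ℂ x (P i x)).im := by
  set d := b - a with hd
  have hor : ∀ z, orient z a b = (starRingEnd ℂ d * (z - a)).im := by
    intro z; rw [orient_eq, hd]; simp; ring
  have hne : ∀ i (t : ℝ), a + t * d - lam i ≠ 0 := by
    intro i t h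
    have h1 := hab _ (hlam i)
    rw [hor] at h1
    have : lam i - a = t * d := by linear_combination -h
    rw [this] at h1
    simp at h1
    exact absurd h1 (by apply not_lt_of_ge; apply le_of_eq; ring)
  have hna : ∀ i, a - lam i ≠ 0 := by
    intro i; simpa using hne i 0
  set f : ℝ → ℝ := fun t => (∑ i, Complex.log ((a + t * d - lam i) / (a - lam i)) * inner ℂ x (P i x)).im with hf
  have hderiv : ∀ t ∈ Set.Icc (0 : ℝ) 1, HasDerivAt f
      (∑ i, d / (a + t * d - lam i) * inner ℂ x (P i x)).im t := by
    intro t ht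
    have h1 : ∀ i ∈ (Finset.univ : Finset ι), HasDerivAt (fun t : ℝ => Complex.log ((a + t * d - lam i) / (a - lam i)) * inner ℂ x (P i x))
        (d / (a + t * d - lam i) * inner ℂ x (P i x)) t := by
      intro i _
      apply HasDerivAt.mul_const
      have hin : HasDerivAt (fun t : ℝ => (a + t * d - lam i) / (a - lam i)) (d / (a - lam i)) t := by
        have h2 : HasDerivAt (fun t : ℝ => (t : ℂ) * d) d t := by
          simpa using (Complex.ofRealCLM.hasDerivAt (x := t)).mul_const d
        exact ((h2.const_add a).sub_const _).div_const _
      have hsl : (a + t * d - lam i) / (a - lam i) ∈ Complex.slitPlane := by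
        rw [Complex.mem_slitPlane_iff]
        rcases ht.1.eq_or_lt with h0 | h0
        · left; rw [← h0]; simp [div_self (hna i)]
        · right
          have e : (a + t * d - lam i) / (a - lam i) = 1 + (t : ℂ) * ((b - lam i) / (a - lam i) - 1) := by
            have := hna i
            field_simp
            rw [hd]; ring
          rw [e]
          have := im_div_pos (hab _ (hlam i))
          simp only [Complex.add_im, Complex.one_im, Complex.im_ofReal_mul, Complex.sub_im]
          simp only [sub_zero, zero_add]
          positivity
      have h3 := hin.clog_real hsl
      convert! h3 using 1
      have := hna i
      have := hne i t
      field_simp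
    have h4 := HasDerivAt.fun_sum h1
    exact (Complex.imCLM.hasFDerivAt (x := _)).comp_hasDerivAt t h4
  have hnn : ∀ t : ℝ, 0 ≤ (∑ i, d / (a + t * d - lam i) * inner ℂ x (P i x)).im := by
    intro t
    set σ := a + t * d with hσ
    set y := ∑ i, (σ - lam i)⁻¹ • P i x with hy
    have hPPx : ∀ i j z, P i (P j z) = if i = j then P i z else 0 := by
      intro i j z
      rw [← mul_apply_eq_comp, hPP]; split_ifs <;> simp
    have hPy : ∀ i, P i y = (σ - lam i)⁻¹ • P i x := by
      intro i
      rw [hy, map_sum]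
      simp [hPPx]
    have hx : x = σ • y - ∑ i, lam i • P i y := by
      have h1 : ∑ i, P i x = x := by
        rw [← _root_.sum_apply, hP1]; simp
      simp_rw [hPy]
      rw [hy, Finset.smul_sum, ← Finset.sum_sub_distrib]
      conv_lhs => rw [← h1]
      apply Finset.sum_congr rfl
      intro i _
      rw [smul_smul, smul_smul, ← sub_smul, ← sub_mul, mul_inv_cancel₀ (hne i t), one_smul]
    have e1 : ∑ i, d / (σ - lam i) * inner ℂ x (P i x) = d * inner ℂ x y := by
      rw [hy, inner_sum, Finset.mul_sum]
      apply Finset.sum_congr rfl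
      intro i _
      rw [inner_smul_right]; ring
    rw [e1]
    have hk := hW (Complex.I * starRingEnd ℂ d) (-(starRingEnd ℂ d * a).im) (by
      intro z hz
      have := hab z hz
      rw [hor, mul_sub, Complex.sub_im] at this
      rw [mul_assoc, Complex.I_mul_re]; linarith) y
    set Ty := ∑ i, lam i • P i y with hTy
    have e2 : inner ℂ x y = starRingEnd ℂ (σ * (‖y‖ ^ 2 : ℝ) - inner ℂ y Ty) := by
      rw [← inner_conj_symm]
      congr 1
      conv_lhs => rw [hx]
      rw [inner_sub_right, inner_smul_right, inner_self_eq_norm_sq_to_K]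
      simp
    rw [e2]
    rw [mul_assoc, Complex.I_mul_re] at hk
    have e3 : (d * starRingEnd ℂ (σ * (‖y‖ ^ 2 : ℝ) - inner ℂ y Ty)).im =
        (starRingEnd ℂ d * inner ℂ y Ty).im - (starRingEnd ℂ d * a).im * ‖y‖ ^ 2 := by
      rw [hσ]
      generalize inner ℂ y Ty = q
      simp [-Complex.ofReal_pow]
      ring
    rw [e3]
    linarith
  have hmono : MonotoneOn f (Set.Icc 0 1) := by
    apply monotoneOn_of_deriv_nonneg (convex_Icc 0 1)
    · intro t ht; exact (hderiv t ht).continuousAt.continuousWithinAt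
    · intro t ht; exact (hderiv t (interior_subset ht)).differentiableAt.differentiableWithinAt
    · intro t ht
      rw [(hderiv t (interior_subset ht)).deriv]
      exact hnn t
  have h01 := hmono (by simp : (0 : ℝ) ∈ Set.Icc (0 : ℝ) 1) (by simp : (1 : ℝ) ∈ Set.Icc (0 : ℝ) 1) zero_le_one
  have hf0 : f 0 = 0 := by
    simp only [hf]
    simp [div_self (hna _)]
  have hf1 : f 1 = (∑ i, lg a b (lam i) * inner ℂ x (P i x)).im := by
    simp only [hf, lg]
    congr 2; ext i; rw [hd]; simp
  rw [← hf1, ← hf0]; exact h01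

end Pos

section CP
variable {H : Type*} [NormedAddCommGroup H] [InnerProductSpace ℂ H] [CompleteSpace H]
variable {ι : Type*} [Fintype ι] [DecidableEq ι]

/-- spectral data of a diagonalizable operator with numerical range in `E` -/
structure SpecData (P : ι → H →L[ℂ] H) (lam : ι → ℂ) (E : Set ℂ) : Prop where
  hPP : ∀ i j, P i * P j = if i = j then P i else 0
  hP1 : ∑ i, P i = 1
  hlam : ∀ i, lam i ∈ E
  hW : ∀ (u : ℂ) (c : ℝ), (∀ z ∈ E, (u * z).re ≤ c) →
      ∀ x : H, (u * inner ℂ x (∑ i, lam i • P i x)).re ≤ c * ‖x‖ ^ 2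

/-- functional calculus with operator coefficients -/
noncomputable def fc (P : ι → H →L[ℂ] H) (lam : ι → ℂ) (F : ℂ → H →L[ℂ] H) : H →L[ℂ] H :=
  ∑ i, F (lam i) * P i

/-- doubly commuting operators -/
def InC (P : ι → H →L[ℂ] H) (C : H →L[ℂ] H) : Prop := ∀ i, Commute C (P i) ∧ Commute C (star (P i))

lemma InC.mul {P : ι → H →L[ℂ] H} {C D : H →L[ℂ] H} (h : InC P C) (h' : InC P D) : InC P (C * D) :=
  fun i => ⟨(h i).1.mul_left (h' i).1, (h i).2.mul_left (h' i).2⟩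

lemma InC.star {P : ι → H →L[ℂ] H} {C : H →L[ℂ] H} (h : InC P C) : InC P (star C) := by
  intro i
  have h1 := (h i).1.star_star
  have h2 := (h i).2.star_star
  rw [star_star] at h2
  exact ⟨h2, h1⟩

lemma InC.smul {P : ι → H →L[ℂ] H} {C : H →L[ℂ] H} (h : InC P C) (c : ℂ) : InC P (c • C) :=
  fun i => ⟨(h i).1.smul_left c, (h i).2.smul_left c⟩

lemma InC.sum {P : ι → H →L[ℂ] H} {κ : Type*} (s : Finset κ) {C : κ → H →L[ℂ] H} (h : ∀ k ∈ s, InC P (C k)) :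
    InC P (∑ k ∈ s, C k) :=
  fun i => ⟨Commute.sum_left _ _ _ (fun k hk => (h k hk i).1), Commute.sum_left _ _ _ (fun k hk => (h k hk i).2)⟩

variable {P : ι → H →L[ℂ] H} {lam : ι → ℂ} {E : Set ℂ}

lemma fc_mul (h : SpecData P lam E) {F G : ℂ → H →L[ℂ] H} (hG : ∀ z, InC P (G z)) :
    fc P lam F * fc P lam G = fc P lam (fun z => F z * G z) := by
  simp only [fc]
  rw [Finset.sum_mul_sum]
  apply Finset.sum_congr rfl
  intro i _
  have : ∀ j ∈ Finset.univ, F (lam i) * P i * (G (lam j) * P j) = if i = j then F (lam i) * G (lam i) * P i else 0 := by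
    intro j _
    calc F (lam i) * P i * (G (lam j) * P j) = F (lam i) * (P i * G (lam j)) * P j := by noncomm_ring
      _ = F (lam i) * (G (lam j) * P i) * P j := by rw [(hG (lam j) i).1.eq]
      _ = F (lam i) * G (lam j) * (P i * P j) := by noncomm_ring
      _ = _ := by
        rw [h.hPP]; split_ifs with hij
        · rw [hij]
        · simp
  rw [Finset.sum_congr rfl this]
  simp

lemma fc_norm_le {b : ℝ} {F : ℂ → H →L[ℂ] H} (hb : ∀ i, ‖F (lam i)‖ ≤ b) :
    ‖fc P lam F‖ ≤ b * ∑ i, ‖P i‖ := by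
  rw [fc, Finset.mul_sum]
  refine (norm_sum_le _ _).trans (Finset.sum_le_sum fun i _ => ?_)
  refine (norm_mul_le _ _).trans ?_
  gcongr
  exact hb i

lemma CP_step (h : SpecData P lam E) (hE : IsCompact E) (hEc : Convex ℝ E) (h0 : (0 : ℂ) ∈ E)
    {F : ℂ → H →L[ℂ] H} {U : Set ℂ} (hU : IsOpen U) (hEU : E ⊆ U) (hF : DifferentiableOn ℂ F U)
    (hFC : ∀ z, InC P (F z)) (hF1 : ∀ z ∈ E, ‖F z‖ ≤ 1) {ε : ℝ} (hε : 0 < ε) :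
    ∃ (G : ℂ → H →L[ℂ] H) (U' : Set ℂ), IsOpen U' ∧ E ⊆ U' ∧ DifferentiableOn ℂ G U' ∧
      (∀ z, InC P (G z)) ∧ (∀ z ∈ E, ‖G z‖ ≤ 1 + ε) ∧ ‖fc P lam F + star (fc P lam G)‖ ≤ 2 + ε := by
  set S := ∑ i, ‖P i‖ with hS
  have hS0 : 0 ≤ S := Finset.sum_nonneg fun i _ => norm_nonneg _
  set ε1 := ε / 4 with hε1
  have hepsOnePos : 0 < ε1 := by positivity
  set ε2 := min ε1 (ε1 / (S + 1)) with hε2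
  have hepsTwoPos : 0 < ε2 := by positivity
  have hε21 : ε2 ≤ ε1 := min_le_left _ _
  have hepsTwoS : ε2 * S ≤ ε1 := by
    calc ε2 * S ≤ ε1 / (S + 1) * S := by gcongr; exact min_le_right _ _
      _ ≤ ε1 := by
        rw [div_mul_eq_mul_div, div_le_iff₀ (by positivity)]; nlinarith
  have hVo : IsOpen (U ∩ (fun z => ‖F z‖) ⁻¹' Set.Iio (1 + ε1)) :=
    hF.continuousOn.norm.isOpen_inter_preimage hU isOpen_Iio
  obtain ⟨g, m, M, R, c0, hg, hR, hRV, hc0, hEg⟩ := gauge_exists hE hEc h0 hVo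
    (fun z hz => ⟨hEU hz, by have := hF1 z hz; simp only [Set.mem_preimage, Set.mem_Iio]; linarith⟩)
  have hFb : ∀ z, g z ≤ 1 → ‖F z‖ ≤ 1 + ε1 := by
    intro z hz
    have : z ∈ {z | g z < R} := lt_of_le_of_lt hz hR
    exact le_of_lt (hRV this).2
  obtain ⟨N, c, hN3, hcp, hc0c, hc1, hor, hsum, hrie, hbd⟩ :=
    hg.poly_data hR (hF.mono fun z hz => (hRV hz).1) hFb hc0 hepsTwoPos
  set v := vert g N with hv
  set el := GaugeLike.el g N with hel
  set G : ℂ → H →L[ℂ] H := fun z => ∑ k ∈ Finset.range N, el k z • star (F (v k)) with hG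
  have hGd : ∀ z, g z ≤ c → DifferentiableAt ℂ G z := by
    intro z hz
    rw [hG]
    apply DifferentiableAt.fun_sum
    intro k _
    apply DifferentiableAt.smul_const
    have := (lg_hasDerivAt (slit_of_orient (hor z hz k))).differentiableAt
    exact this.div_const _
  have hEc' : ∀ z ∈ E, g z < c := fun z hz => lt_of_le_of_lt (hEg z hz) hc0c
  have hclos : closure {z | g z < c} ⊆ {z | g z ≤ c} := closure_lt_subset_le hg.cont continuous_const
  have hGb : ∀ z ∈ E, ‖G z‖ ≤ 1 + ε := by
    intro z hz
    have hbound : Bornology.IsBounded {z | g z < c} :=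
      (hg.isCompact_le c).isBounded.subset (fun z (hz : g z < c) => hz.le)
    have hdc : DiffContOnCl ℂ G {z | g z < c} := by
      apply DifferentiableOn.diffContOnCl
      intro w hw
      exact (hGd w (hclos hw)).differentiableWithinAt
    have h1 := Complex.norm_le_of_forall_mem_frontier_norm_le hbound hdc (C := 1 + ε1 + ε2) (by
      intro w hw
      have hw' : g w = c := frontier_lt_subset_eq hg.cont continuous_const hw
      have h2 := hbd w hw'
      rw [← norm_star] at h2
      have e0 : G w = star (∑ k ∈ Finset.range N, (starRingEnd ℂ) (el k w) • F (v k)) := by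
        rw [hG, star_sum]
        apply Finset.sum_congr rfl
        intro k _
        rw [star_smul]
        simp
      rw [e0]; exact h2) (subset_closure (hEc' z hz))
    refine h1.trans ?_
    linarith
  refine ⟨G, {z | g z < c}, hg.isOpen_lt c, hEc', fun z (hz : g z < c) => (hGd z hz.le).differentiableWithinAt,
    fun z => InC.sum _ fun k _ => (hFC (v k)).star.smul _, hGb, ?_⟩
  -- operators
  set ell : ℕ → H →L[ℂ] H := fun k => ∑ i, el k (lam i) • P i with hell
  set Mk : ℕ → H →L[ℂ] H := fun k => ell k + star (ell k) with hMk
  have hlc : ∀ i, g (lam i) ≤ c := fun i => (hEc' _ (h.hlam i)).le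
  have hMpos : ∀ k, 0 ≤ Mk k := by
    intro k
    rw [ContinuousLinearMap.nonneg_iff_isPositive, ContinuousLinearMap.isPositive_def]
    constructor
    · have : IsSelfAdjoint (Mk k) := by
        rw [hMk]; exact IsSelfAdjoint.add_star_self _
      exact this.isSymmetric
    · intro x
      rw [ContinuousLinearMap.reApplyInnerSelf_apply]
      have him := im_lg_nonneg P lam h.hPP h.hP1 h.hlam h.hW (a := v k) (b := v (k + 1))
        (fun z hz => hor z (hEc' z hz).le k) x
      have e1 : inner ℂ x (ell k x) = (∑ i, lg (v k) (v (k + 1)) (lam i) * inner ℂ x (P i x)) / (2 * Real.pi * Complex.I) := by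
        simp only [hell]
        rw [_root_.sum_apply, inner_sum, Finset.sum_div]
        apply Finset.sum_congr rfl
        intro i _
        rw [_root_.smul_apply, inner_smul_right, hel, GaugeLike.el]
        ring
      have e2 : (inner ℂ (Mk k x) x).re = 2 * (inner ℂ x (ell k x)).re := by
        simp only [hMk]
        rw [_root_.add_apply, inner_add_left, ContinuousLinearMap.star_eq_adjoint, ContinuousLinearMap.adjoint_inner_left,
          ← inner_conj_symm, Complex.add_re, Complex.conj_re]
        ring
      change 0 ≤ (inner ℂ (Mk k x) x).re
      rw [e2, e1]
      set w := ∑ i, lg (v k) (v (k + 1)) (lam i) * inner ℂ x (P i x)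
      have e3 : (w / (2 * Real.pi * Complex.I)) = ((1 / (2 * Real.pi) : ℝ) : ℂ) * (-(Complex.I * w)) := by
        have hp : (Real.pi : ℂ) ≠ 0 := by exact_mod_cast Real.pi_ne_zero
        push_cast
        field_simp
        rw [Complex.I_sq]; ring
      rw [e3, Complex.re_ofReal_mul, Complex.neg_re, Complex.I_mul_re, neg_neg]
      have := Real.pi_pos
      positivity
  have hell1 : ∑ k ∈ Finset.range N, ell k = 1 := by
    simp only [hell]
    rw [Finset.sum_comm, ← h.hP1]
    apply Finset.sum_congr rfl
    intro i _
    rw [← Finset.sum_smul, hsum _ (hlc i), one_smul]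
  have hMsum : ∑ k ∈ Finset.range N, Mk k = 2 := by
    simp only [hMk]
    rw [Finset.sum_add_distrib, ← star_sum, hell1, star_one, one_add_one_eq_two]
  have hcomm : ∀ C, InC P C → ∀ k, Commute C (ell k) ∧ Commute C (star (ell k)) := by
    intro C hC k
    have : ∀ C, InC P C → Commute C (ell k) := fun C hC =>
      Commute.sum_right _ _ _ (fun i _ => (hC i).1.smul_right _)
    refine ⟨this C hC, ?_⟩
    have h2 := (this _ hC.star).star_star
    rwa [star_star] at h2
  have hmain := norm_sum_pos (Finset.range N) Mk (fun k => F (v k)) (fun k _ => hMpos k) hMsum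
    (b := 1 + ε1) (by positivity) (fun k _ => hFb _ (hg.g_vert N k).le)
    (fun k _ => ((hcomm _ (hFC (v k)) k).1.add_right (hcomm _ (hFC (v k)) k).2).symm)
  set FN : ℂ → H →L[ℂ] H := fun z => ∑ k ∈ Finset.range N, el k z • F (v k) with hFN
  have e1 : fc P lam FN = ∑ k ∈ Finset.range N, F (v k) * ell k := by
    simp only [fc, hFN, hell]
    simp_rw [Finset.sum_mul, Finset.mul_sum]
    rw [Finset.sum_comm]
    simp
  have e2 : star (fc P lam G) = ∑ k ∈ Finset.range N, F (v k) * star (ell k) := by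
    have : fc P lam G = ∑ k ∈ Finset.range N, star (F (v k)) * ell k := by
      simp only [fc, hG, hell]
      simp_rw [Finset.sum_mul, Finset.mul_sum]
      rw [Finset.sum_comm]
      simp
    rw [this, star_sum]
    apply Finset.sum_congr rfl
    intro k _
    rw [star_mul, star_star, (hcomm _ (hFC (v k)) k).2.eq]
  have e3 : ∑ k ∈ Finset.range N, F (v k) * Mk k = fc P lam FN + star (fc P lam G) := by
    rw [e1, e2, ← Finset.sum_add_distrib]
    simp only [hMk, mul_add]
  have e4 : fc P lam F + star (fc P lam G) = ∑ k ∈ Finset.range N, F (v k) * Mk k - fc P lam (fun z => FN z - F z) := by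
    rw [e3]
    have : fc P lam (fun z => FN z - F z) = fc P lam FN - fc P lam F := by
      simp only [fc, sub_mul, Finset.sum_sub_distrib]
    rw [this]; abel
  rw [e4]
  have h5 : ‖fc P lam (fun z => FN z - F z)‖ ≤ ε2 * S := fc_norm_le fun i => hrie _ (hlc i)
  refine (norm_sub_le _ _).trans ?_
  linarith

/-- admissible values -/
def CPset (P : ι → H →L[ℂ] H) (lam : ι → ℂ) (E : Set ℂ) : Set ℝ :=
  {r | ∃ (F : ℂ → H →L[ℂ] H) (U : Set ℂ), IsOpen U ∧ E ⊆ U ∧ DifferentiableOn ℂ F U ∧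
    (∀ z, InC P (F z)) ∧ (∀ z ∈ E, ‖F z‖ ≤ 1) ∧ r = ‖fc P lam F‖}

lemma CP_zero (h : SpecData P lam E) (hE : IsCompact E) (hEc : Convex ℝ E) (h0 : (0 : ℂ) ∈ E)
    {r : ℝ} (hr : r ∈ CPset P lam E) : r ≤ 1 + Real.sqrt 2 := by
  have hbdd : BddAbove (CPset P lam E) := by
    refine ⟨1 * ∑ i, ‖P i‖, ?_⟩
    rintro _ ⟨F, U, -, -, -, -, hF1, rfl⟩
    exact fc_norm_le fun i => hF1 _ (h.hlam i)
  set K := sSup (CPset P lam E) with hK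
  have key : ∀ r ∈ CPset P lam E, r ^ 4 ≤ 2 * r ^ 3 + K * r := by
    rintro _ ⟨F, U, hU, hEU, hF, hFC, hF1, rfl⟩
    set f := fc P lam F with hf
    have hstep : ∀ ε > 0, ‖f‖ ^ 4 ≤ (2 + ε) * ‖f‖ ^ 3 + (1 + ε) * K * ‖f‖ := by
      intro ε hε
      obtain ⟨G, U', hU', hEU', hGd, hGC, hG1, hq⟩ := CP_step h hE hEc h0 hU hEU hF hFC hF1 hε
      set γ := fc P lam G with hγ
      set q := f + star γ with hqd
      have hsf : star f = star q - γ := by rw [hqd]; simp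
      have hfgf : ‖f * γ * f‖ ≤ (1 + ε) * K := by
        have e : f * γ * f = ((1 + ε : ℝ) : ℂ) • fc P lam (fun z => (((1 + ε)⁻¹ : ℝ) : ℂ) • (F z * G z * F z)) := by
          rw [hf, hγ, fc_mul h hGC, fc_mul h hFC]
          simp only [fc]
          rw [Finset.smul_sum]
          apply Finset.sum_congr rfl
          intro i _
          rw [smul_mul_assoc, smul_smul, ← Complex.ofReal_mul, mul_inv_cancel₀ (by positivity)]
          simp
        rw [e, norm_smul, Complex.norm_real, Real.norm_eq_abs, abs_of_pos (by positivity)]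
        gcongr
        apply le_csSup hbdd
        refine ⟨_, U ∩ U', hU.inter hU', Set.subset_inter hEU hEU', ?_, ?_, ?_, rfl⟩
        · have h1 := hF.mono (Set.inter_subset_left (t := U'))
          have h2 := hGd.mono (Set.inter_subset_right (s := U))
          exact ((h1.mul h2).mul h1).fun_const_smul (((1 + ε)⁻¹ : ℝ) : ℂ)
        · intro z; exact (((hFC z).mul (hGC z)).mul (hFC z)).smul _
        · intro z hz
          rw [norm_smul, Complex.norm_real, Real.norm_eq_abs, abs_of_pos (by positivity), inv_mul_le_iff₀ (by positivity), mul_one]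
          have a1 := hF1 z hz
          have a2 := hG1 z hz
          calc ‖F z * G z * F z‖ ≤ ‖F z‖ * ‖G z‖ * ‖F z‖ :=
                (norm_mul_le _ _).trans (mul_le_mul_of_nonneg_right (norm_mul_le _ _) (norm_nonneg _))
            _ ≤ 1 * (1 + ε) * 1 := by gcongr
            _ = 1 + ε := by ring
      have e1 : ‖f‖ ^ 4 = ‖f * star f * (f * star f)‖ := by
        have hsa : star (f * star f) = f * star f := by simp
        have h1 : ‖f * star f * (f * star f)‖ = ‖f * star f‖ * ‖f * star f‖ := by
          nth_rewrite 1 [← hsa]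
          rw [CStarRing.norm_star_mul_self]
        rw [h1, CStarRing.norm_self_mul_star]; ring
      have e2 : f * star f * (f * star f) = f * star q * f * star f - f * γ * f * star f := by
        nth_rewrite 1 [hsf]; noncomm_ring
      rw [e1, e2]
      refine (norm_sub_le _ _).trans ?_
      have hn : ‖star f‖ = ‖f‖ := norm_star f
      have hnq : ‖star q‖ ≤ 2 + ε := by rw [norm_star]; exact hq
      have b1 : ‖f * star q * f * star f‖ ≤ (2 + ε) * ‖f‖ ^ 3 := by
        calc ‖f * star q * f * star f‖ ≤ ‖f‖ * ‖star q‖ * ‖f‖ * ‖star f‖ := by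
              refine (norm_mul_le _ _).trans (mul_le_mul_of_nonneg_right ?_ (norm_nonneg _))
              refine (norm_mul_le _ _).trans (mul_le_mul_of_nonneg_right ?_ (norm_nonneg _))
              exact norm_mul_le _ _
          _ ≤ ‖f‖ * (2 + ε) * ‖f‖ * ‖f‖ := by rw [hn]; gcongr
          _ = _ := by ring
      have b2 : ‖f * γ * f * star f‖ ≤ (1 + ε) * K * ‖f‖ := by
        refine (norm_mul_le _ _).trans ?_
        rw [hn]; gcongr
      linarith
    have ht : Filter.Tendsto (fun ε : ℝ => (2 + ε) * ‖f‖ ^ 3 + (1 + ε) * K * ‖f‖) (nhdsWithin 0 (Set.Ioi 0))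
        (nhds ((2 + 0) * ‖f‖ ^ 3 + (1 + 0) * K * ‖f‖)) := by
      apply Filter.Tendsto.mono_left _ nhdsWithin_le_nhds
      apply Continuous.tendsto
      fun_prop
    have := ge_of_tendsto ht (Filter.eventually_of_mem self_mem_nhdsWithin fun ε hε => hstep ε hε)
    simpa using this
  obtain ⟨u, -, hu, hus⟩ := exists_seq_tendsto_sSup ⟨r, hr⟩ hbdd
  have hKK : K ^ 4 ≤ 2 * K ^ 3 + K * K :=
    le_of_tendsto_of_tendsto' (hu.pow 4) (((hu.pow 3).const_mul 2).add (hu.const_mul K)) fun n => key _ (hus n)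
  refine (le_csSup hbdd hr).trans ?_
  rw [← hK]
  have hs := Real.sqrt_nonneg 2
  have hs2 := Real.sq_sqrt (show (0 : ℝ) ≤ 2 by norm_num)
  by_contra hcon
  push Not at hcon
  have hKp : 0 < K := by linarith
  have h3 : K ^ 2 * (K ^ 2 - 2 * K - 1) ≤ 0 := by nlinarith
  have h4 : 0 < K ^ 2 - 2 * K - 1 := by nlinarith
  have : 0 < K ^ 2 * (K ^ 2 - 2 * K - 1) := by positivity
  linarith

theorem CP_main (h : SpecData P lam E) (hE : IsCompact E) (hEc : Convex ℝ E)
    {F : ℂ → H →L[ℂ] H} {U : Set ℂ} (hU : IsOpen U) (hEU : E ⊆ U) (hF : DifferentiableOn ℂ F U)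
    (hFC : ∀ z, InC P (F z)) {b : ℝ} (hb : 0 ≤ b) (hFb : ∀ z ∈ E, ‖F z‖ ≤ b) :
    ‖fc P lam F‖ ≤ (1 + Real.sqrt 2) * b := by
  rcases hb.eq_or_lt with rfl | hb
  · have := fc_norm_le (P := P) (lam := lam) (fun i => hFb _ (h.hlam i))
    simpa using this
  rcases isEmpty_or_nonempty ι with hι | ⟨⟨i0⟩⟩
  · simp [fc]; positivity
  set e := lam i0 with he
  have heE : e ∈ E := h.hlam i0
  have hsum : ∀ x : H, ∑ i, P i x = x := fun x => by
    rw [← _root_.sum_apply, h.hP1]; simp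
  have h' : SpecData P (fun i => lam i - e) ((fun z => z + e) ⁻¹' E) := by
    refine ⟨h.hPP, h.hP1, fun i => by simpa using h.hlam i, ?_⟩
    intro u c hu x
    have := h.hW u (c + (u * e).re) (by
      intro z hz
      have := hu (z - e) (by simpa using hz)
      rw [mul_sub, Complex.sub_re] at this
      linarith) x
    have e1 : ∑ i, (lam i - e) • P i x = ∑ i, lam i • P i x - e • x := by
      simp_rw [sub_smul]
      rw [Finset.sum_sub_distrib, ← Finset.smul_sum, hsum]
    rw [e1, inner_sub_right, inner_smul_right, inner_self_eq_norm_sq_to_K, mul_sub, Complex.sub_re]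
    have e2 : (u * (e * ((‖x‖ : ℝ) : ℂ) ^ 2)).re = (u * e).re * ‖x‖ ^ 2 := by
      rw [← mul_assoc, ← Complex.ofReal_pow, mul_comm, Complex.re_ofReal_mul]; ring
    change _ - (u * (e * ((‖x‖ : ℝ) : ℂ) ^ 2)).re ≤ _
    rw [e2]; linarith
  have hcp := CP_zero h' (r := ‖fc P (fun i => lam i - e) (fun z => ((b⁻¹ : ℝ) : ℂ) • F (z + e))‖)
    ((Homeomorph.addRight e).isClosedEmbedding.isCompact_preimage hE)
    (by
      intro x hx y hy s t hs ht hst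
      have := hEc hx hy hs ht hst
      simp only [Set.mem_preimage] at *
      convert this using 1
      simp only [smul_add]
      have : e = s • e + t • e := by rw [← add_smul, hst, one_smul]
      nth_rewrite 1 [this]; abel)
    (by simpa using heE)
    ⟨_, (fun z => z + e) ⁻¹' U, hU.preimage (by fun_prop), fun z hz => hEU hz,
      DifferentiableOn.fun_const_smul (hF.comp (t := U) (f := fun z => z + e) (by fun_prop) (fun z hz => hz)) ((b⁻¹ : ℝ) : ℂ), fun z => (hFC _).smul _, fun z hz => by
        rw [norm_smul, Complex.norm_real, Real.norm_eq_abs, abs_of_pos (by positivity), inv_mul_le_iff₀ hb, mul_one]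
        exact hFb _ hz, rfl⟩
  have e3 : fc P (fun i => lam i - e) (fun z => ((b⁻¹ : ℝ) : ℂ) • F (z + e)) = ((b⁻¹ : ℝ) : ℂ) • fc P lam F := by
    simp only [fc, sub_add_cancel, smul_mul_assoc, Finset.smul_sum]
  rw [e3, norm_smul, Complex.norm_real, Real.norm_eq_abs, abs_of_pos (by positivity), inv_mul_le_iff₀ hb] at hcp
  linarith

end CP

open scoped Kronecker

section Twice
variable {n : ℕ}

lemma star_dot_self (y : Fin n → ℂ) : star y ⬝ᵥ y = ((∑ i, ‖y i‖ ^ 2 : ℝ) : ℂ) := by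
  simp only [dotProduct, Pi.star_apply]
  push_cast
  apply Finset.sum_congr rfl
  intro i _
  rw [mul_comm]
  exact Complex.mul_conj' (y i)

lemma numRange_half {A : Matrix (Fin n) (Fin n) ℂ} {E : Set ℂ} (hA : numRange A ⊆ E) {u : ℂ} {c : ℝ}
    (hu : ∀ z ∈ E, (u * z).re ≤ c) (y : Fin n → ℂ) :
    (u * (star y ⬝ᵥ A.mulVec y)).re ≤ c * ∑ i, ‖y i‖ ^ 2 := by
  set s := ∑ i, ‖y i‖ ^ 2 with hs
  have hs0 : 0 ≤ s := Finset.sum_nonneg fun i _ => by positivity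
  rcases hs0.eq_or_lt with h0 | hpos
  · have hy : y = 0 := by
      ext i
      have := (Finset.sum_eq_zero_iff_of_nonneg (fun i _ => by positivity)).1 (hs ▸ h0.symm) i (Finset.mem_univ i)
      simpa using this
    rw [← h0, hy]; simp
  set r := Real.sqrt s with hr
  have hrp : 0 < r := Real.sqrt_pos.2 hpos
  have hrr : r * r = s := Real.mul_self_sqrt hs0
  have hrc : (r : ℂ) ≠ 0 := by exact_mod_cast hrp.ne'
  set x : Fin n → ℂ := ((r : ℂ)⁻¹) • y with hx
  have hsx : star x = ((r : ℂ)⁻¹) • star y := by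
    rw [hx, star_smul]; simp
  have hx1 : star x ⬝ᵥ x = 1 := by
    rw [hsx, hx, smul_dotProduct, dotProduct_smul, star_dot_self, ← hs, ← hrr]
    push_cast
    simp only [smul_eq_mul]; field_simp
  have h1 := hu _ (hA ⟨x, hx1, rfl⟩)
  have e : star y ⬝ᵥ A.mulVec y = (s : ℂ) * (star x ⬝ᵥ A.mulVec x) := by
    rw [hsx, hx, mulVec_smul, smul_dotProduct, dotProduct_smul, ← hrr]
    push_cast
    simp only [smul_eq_mul]; field_simp
  rw [e, mul_left_comm, Complex.re_ofReal_mul]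
  nlinarith

/-- vectorization as a Euclidean vector -/
noncomputable def vv (X : Matrix (Fin n) (Fin n) ℂ) : EuclideanSpace ℂ (Fin n × Fin n) := WithLp.toLp 2 X.vec

lemma vv_surj (x : EuclideanSpace ℂ (Fin n × Fin n)) : ∃ X, x = vv X :=
  ⟨Matrix.of fun i j => x (j, i), by ext ⟨j, i⟩; rfl⟩

lemma norm_vv (X : Matrix (Fin n) (Fin n) ℂ) : ‖vv X‖ = frobNorm X := by
  rw [EuclideanSpace.norm_eq, frobNorm, Fintype.sum_prod_type, Finset.sum_comm]
  rfl

lemma norm_vv_sq (X : Matrix (Fin n) (Fin n) ℂ) : ‖vv X‖ ^ 2 = ∑ i, ∑ j, ‖X i j‖ ^ 2 := by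
  rw [norm_vv, frobNorm, Real.sq_sqrt]
  exact Finset.sum_nonneg fun i _ => Finset.sum_nonneg fun j _ => by positivity

lemma inner_vv (X Y : Matrix (Fin n) (Fin n) ℂ) : inner ℂ (vv X) (vv Y) = ∑ j, ∑ i, Y i j * star (X i j) := by
  rw [vv, vv, EuclideanSpace.inner_toLp_toLp, dotProduct, Fintype.sum_prod_type]
  rfl

lemma vv_add (X Y : Matrix (Fin n) (Fin n) ℂ) : vv (X + Y) = vv X + vv Y := rfl
lemma vv_smul (c : ℂ) (X : Matrix (Fin n) (Fin n) ℂ) : vv (c • X) = c • vv X := rfl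
lemma vv_zero : vv (0 : Matrix (Fin n) (Fin n) ℂ) = 0 := rfl
lemma vv_sum {ι : Type*} (s : Finset ι) (X : ι → Matrix (Fin n) (Fin n) ℂ) : vv (∑ i ∈ s, X i) = ∑ i ∈ s, vv (X i) := by
  classical
  induction s using Finset.induction_on with
  | empty => simp [vv_zero]
  | insert a s ha ih => rw [Finset.sum_insert ha, Finset.sum_insert ha, vv_add, ih]

noncomputable def LL (B : Matrix (Fin n) (Fin n) ℂ) :
    EuclideanSpace ℂ (Fin n × Fin n) →L[ℂ] EuclideanSpace ℂ (Fin n × Fin n) :=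
  toEuclideanCLM (𝕜 := ℂ) ((1 : Matrix (Fin n) (Fin n) ℂ) ⊗ₖ B)

noncomputable def RR (A : Matrix (Fin n) (Fin n) ℂ) :
    EuclideanSpace ℂ (Fin n × Fin n) →L[ℂ] EuclideanSpace ℂ (Fin n × Fin n) :=
  toEuclideanCLM (𝕜 := ℂ) (Aᵀ ⊗ₖ (1 : Matrix (Fin n) (Fin n) ℂ))

lemma LL_vv (B X : Matrix (Fin n) (Fin n) ℂ) : LL B (vv X) = vv (B * X) := by
  rw [LL, vv, toEuclideanCLM_toLp, kronecker_mulVec_vec]; simp [vv]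

lemma RR_vv (A X : Matrix (Fin n) (Fin n) ℂ) : RR A (vv X) = vv (X * A) := by
  rw [RR, vv, toEuclideanCLM_toLp, kronecker_mulVec_vec]; simp [vv]

lemma star_LL (B : Matrix (Fin n) (Fin n) ℂ) : star (LL B) = LL Bᴴ := by
  rw [LL, LL, ← map_star, star_eq_conjTranspose, conjTranspose_kronecker]; simp

lemma op_ext {S T : EuclideanSpace ℂ (Fin n × Fin n) →L[ℂ] EuclideanSpace ℂ (Fin n × Fin n)}
    (h : ∀ X, S (vv X) = T (vv X)) : S = T := by
  ext1 x
  obtain ⟨X, rfl⟩ := vv_surj x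
  exact h X

lemma LL_RR_comm (B A : Matrix (Fin n) (Fin n) ℂ) : Commute (LL B) (RR A) := by
  apply op_ext
  intro X
  rw [mul_apply_eq_comp, mul_apply_eq_comp, RR_vv, LL_vv, LL_vv, RR_vv, mul_assoc]

/-- spectral decomposition of a matrix -/
structure MatSpec (A : Matrix (Fin n) (Fin n) ℂ) (P : Fin n → Matrix (Fin n) (Fin n) ℂ) (lam : Fin n → ℂ) : Prop where
  hPP : ∀ i j, P i * P j = if i = j then P i else 0
  hP1 : ∑ i, P i = 1
  hA : ∑ i, lam i • P i = A

lemma MatSpec.mulA {A : Matrix (Fin n) (Fin n) ℂ} {P lam} (h : MatSpec A P lam) (i : Fin n) : P i * A = lam i • P i := by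
  rw [← h.hA, Finset.mul_sum]
  simp [h.hPP]

lemma MatSpec.Amul {A : Matrix (Fin n) (Fin n) ℂ} {P lam} (h : MatSpec A P lam) (i : Fin n) : A * P i = lam i • P i := by
  rw [← h.hA, Finset.sum_mul]
  simp [h.hPP]

lemma MatSpec.aeval {A : Matrix (Fin n) (Fin n) ℂ} {P lam} (h : MatSpec A P lam) (p : ℂ[X]) :
    Polynomial.aeval A p = ∑ i, p.eval (lam i) • P i := by
  induction p using Polynomial.induction_on' with
  | add p q hp hq => simp only [map_add, hp, hq, eval_add, add_smul, Finset.sum_add_distrib]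
  | monomial k c =>
    rw [aeval_monomial]
    have : ∀ k : ℕ, A ^ k = ∑ i, lam i ^ k • P i := by
      intro k
      induction k with
      | zero => simp [h.hP1]
      | succ k ih =>
        rw [pow_succ, ih, Finset.sum_mul]
        apply Finset.sum_congr rfl
        intro i _
        rw [smul_mul_assoc, h.mulA, smul_smul, pow_succ]
    rw [this, Finset.mul_sum]
    apply Finset.sum_congr rfl
    intro i _
    rw [eval_monomial, ← smul_smul, Algebra.algebraMap_eq_smul_one, smul_mul_assoc, one_mul]

lemma specLL {B : Matrix (Fin n) (Fin n) ℂ} {P lam} (h : MatSpec B P lam) {E : Set ℂ} (hB : numRange B ⊆ E)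
    (hlam : ∀ i, lam i ∈ E) : SpecData (fun i => LL (P i)) lam E := by
  refine ⟨?_, ?_, hlam, ?_⟩
  · intro i j
    apply op_ext
    intro X
    rw [mul_apply_eq_comp, LL_vv, LL_vv, ← mul_assoc, h.hPP]
    split_ifs
    · rw [LL_vv]
    · simp [vv_zero]
  · apply op_ext
    intro X
    rw [_root_.sum_apply]
    simp_rw [LL_vv]
    rw [← vv_sum, ← Finset.sum_mul, h.hP1]; simp
  · intro u c hu x
    obtain ⟨X, rfl⟩ := vv_surj x
    simp_rw [LL_vv, ← vv_smul]
    rw [← vv_sum]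
    simp_rw [← smul_mul_assoc]
    rw [← Finset.sum_mul, h.hA, inner_vv, norm_vv_sq, Finset.sum_comm (γ := Fin n) (f := fun i j => ‖X i j‖ ^ 2),
      Finset.mul_sum, Complex.re_sum, Finset.mul_sum]
    apply Finset.sum_le_sum
    intro j _
    have := numRange_half hB hu (fun i => X i j)
    have e : ∑ i, (B * X) i j * star (X i j) = star (fun i => X i j) ⬝ᵥ B.mulVec (fun i => X i j) := by
      simp only [dotProduct, Matrix.mul_apply, mulVec, Pi.star_apply]
      apply Finset.sum_congr rfl
      intro i _
      rw [mul_comm]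
    rw [e]
    exact this

lemma specRR {A : Matrix (Fin n) (Fin n) ℂ} {P lam} (h : MatSpec A P lam) {E : Set ℂ} (hA : numRange A ⊆ E)
    (hlam : ∀ i, lam i ∈ E) : SpecData (fun i => RR (P i)) lam E := by
  refine ⟨?_, ?_, hlam, ?_⟩
  · intro i j
    apply op_ext
    intro X
    rw [mul_apply_eq_comp, RR_vv, RR_vv, mul_assoc, h.hPP]
    by_cases hij : i = j
    · simp [hij, RR_vv]
    · simp [hij, Ne.symm hij, vv_zero]
  · apply op_ext
    intro X
    rw [_root_.sum_apply]
    simp_rw [RR_vv]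
    rw [← vv_sum, ← Finset.mul_sum, h.hP1]; simp
  · intro u c hu x
    obtain ⟨X, rfl⟩ := vv_surj x
    simp_rw [RR_vv, ← vv_smul]
    rw [← vv_sum]
    simp_rw [← mul_smul_comm]
    rw [← Finset.mul_sum, h.hA, inner_vv, norm_vv_sq, Finset.sum_comm,
      Finset.mul_sum, Complex.re_sum, Finset.mul_sum]
    apply Finset.sum_le_sum
    intro i _
    have := numRange_half hA hu (fun j => star (X i j))
    have e : ∑ j, (X * A) i j * star (X i j) =
        star (fun j => star (X i j)) ⬝ᵥ A.mulVec (fun j => star (X i j)) := by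
      simp only [dotProduct, Matrix.mul_apply, mulVec, Pi.star_apply, star_star, Finset.sum_mul, Finset.mul_sum]
      rw [Finset.sum_comm]
      apply Finset.sum_congr rfl
      intro j _
      apply Finset.sum_congr rfl
      intro k _
      ring
    rw [e]
    simp only [norm_star] at this
    exact this

lemma dslope_symm (p : ℂ[X]) (a b : ℂ) : dslope (fun x => p.eval x) a b = dslope (fun x => p.eval x) b a := by
  rcases eq_or_ne a b with rfl | h
  · rfl
  · rw [dslope_of_ne _ h.symm, dslope_of_ne _ h, slope_comm]

lemma dslope_bound (p : ℂ[X]) {E : Set ℂ} (hE : Convex ℝ E) {M : ℝ}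
    (hM : ∀ z ∈ E, ‖(derivative p).eval z‖ ≤ M) {a b : ℂ} (ha : a ∈ E) (hb : b ∈ E) :
    ‖dslope (fun x => p.eval x) a b‖ ≤ M := by
  rcases eq_or_ne b a with rfl | h
  · rw [dslope_same, Polynomial.deriv]; exact hM _ ha
  · have h1 := Convex.norm_image_sub_le_of_norm_hasDerivWithin_le (f := fun x => p.eval x)
      (fun x hx => (p.hasDerivAt x).hasDerivWithinAt) hM hE ha hb
    have h2 := sub_smul_dslope (fun x => p.eval x) a b
    change (b - a) • dslope (fun x => p.eval x) a b = p.eval b - p.eval a at h2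
    rw [← h2, norm_smul, mul_comm] at h1
    exact le_of_mul_le_mul_right h1 (norm_pos_iff.2 (sub_ne_zero.2 h))

theorem diag_bound {A B : Matrix (Fin n) (Fin n) ℂ} {P Q lam rho} (hB : MatSpec B P lam) (hA : MatSpec A Q rho)
    {E : Set ℂ} (hE : IsCompact E) (hEc : Convex ℝ E) (hBE : numRange B ⊆ E) (hAE : numRange A ⊆ E)
    (hlam : ∀ i, lam i ∈ E) (hrho : ∀ i, rho i ∈ E) (p : ℂ[X]) {M : ℝ} (hM0 : 0 ≤ M)
    (hM : ∀ z ∈ E, ‖(derivative p).eval z‖ ≤ M) :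
    frobNorm (aeval B p - aeval A p) ≤ (1 + Real.sqrt 2) ^ 2 * M * frobNorm (B - A) := by
  set f : ℂ → ℂ := fun x => p.eval x with hf
  have hfd : ∀ a, Differentiable ℂ (dslope f a) := by
    intro a
    rw [← differentiableOn_univ, Complex.differentiableOn_dslope Filter.univ_mem]
    exact p.differentiable.differentiableOn
  set F2 : ℂ → EuclideanSpace ℂ (Fin n × Fin n) →L[ℂ] EuclideanSpace ℂ (Fin n × Fin n) :=
    fun z => ∑ j, dslope f (rho j) z • RR (Q j) with hF2
  have hF2b : ∀ z ∈ E, ‖F2 z‖ ≤ (1 + Real.sqrt 2) * M := by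
    intro z hz
    have h1 := CP_main (specRR hA hAE hrho) hE hEc isOpen_univ (Set.subset_univ _)
      (F := fun w => dslope f z w • 1) ((hfd z).smul_const _).differentiableOn
      (fun w i => ⟨(Commute.one_left _).smul_left _, (Commute.one_left _).smul_left _⟩) hM0 (by
        intro w hw
        rw [norm_smul]
        calc _ ≤ M * 1 := by
              gcongr
              · exact dslope_bound p hEc hM hz hw
              · exact ContinuousLinearMap.norm_id_le
          _ = M := mul_one _)
    convert! h1 using 2
    simp only [hF2, fc]
    apply Finset.sum_congr rfl
    intro j _
    rw [smul_mul_assoc, one_mul, dslope_symm]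
  have h2 := CP_main (specLL hB hBE hlam) hE hEc isOpen_univ (Set.subset_univ _)
      (F := F2) (by
        apply Differentiable.differentiableOn
        rw [hF2]
        apply Differentiable.fun_sum
        intro j _
        exact (hfd _).smul_const _)
      (fun w => InC.sum _ fun j _ => InC.smul (fun i => ⟨(LL_RR_comm _ _).symm, by
        rw [star_LL]; exact (LL_RR_comm _ _).symm⟩) _) (by positivity) hF2b
  have h3 := (fc (fun i => LL (P i)) lam F2).le_opNorm (vv (B - A))
  have e : fc (fun i => LL (P i)) lam F2 (vv (B - A)) = vv (aeval B p - aeval A p) := by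
    have e1 : fc (fun i => LL (P i)) lam F2 (vv (B - A)) =
        vv (∑ i, ∑ j, dslope f (rho j) (lam i) • (P i * (B - A) * Q j)) := by
      simp only [fc, hF2]
      rw [_root_.sum_apply, vv_sum]
      apply Finset.sum_congr rfl
      intro i _
      rw [mul_apply_eq_comp, LL_vv, _root_.sum_apply, vv_sum]
      apply Finset.sum_congr rfl
      intro j _
      rw [_root_.smul_apply, RR_vv, vv_smul]
    rw [e1]
    congr 1
    have e2 : ∀ i j, dslope f (rho j) (lam i) • (P i * (B - A) * Q j) = (f (lam i)) • (P i * Q j) - f (rho j) • (P i * Q j) := by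
      intro i j
      have : P i * (B - A) * Q j = (lam i - rho j) • (P i * Q j) := by
        rw [mul_sub, sub_mul, hB.mulA, mul_assoc, hA.Amul, smul_mul_assoc, mul_smul_comm, sub_smul]
      rw [this, smul_smul, ← sub_smul, mul_comm, ← smul_eq_mul, sub_smul_dslope]
    simp_rw [e2, Finset.sum_sub_distrib]
    rw [hB.aeval, hA.aeval]
    congr 1
    · apply Finset.sum_congr rfl
      intro i _
      rw [← Finset.smul_sum, ← Finset.mul_sum, hA.hP1, mul_one]
    · rw [Finset.sum_comm]
      apply Finset.sum_congr rfl
      intro j _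
      rw [← Finset.smul_sum, ← Finset.sum_mul, hB.hP1, one_mul]
  rw [e, norm_vv, norm_vv] at h3
  have hfn : 0 ≤ frobNorm (B - A) := Real.sqrt_nonneg _
  calc _ ≤ _ := h3
    _ ≤ ((1 + Real.sqrt 2) * ((1 + Real.sqrt 2) * M)) * frobNorm (B - A) := by gcongr
    _ = _ := by ring

end Twice

section Final
variable {n : ℕ}

lemma eigen_numRange {T : Matrix (Fin n) (Fin n) ℂ} {z : ℂ} (hz : T.charpoly.IsRoot z) : z ∈ numRange T := by
  have h0 : (scalar (Fin n) z - T).det = 0 := by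
    rw [← Matrix.eval_charpoly]; exact hz
  obtain ⟨v, hv, hv0⟩ := Matrix.exists_mulVec_eq_zero_iff.2 h0
  have hTv : T.mulVec v = z • v := by
    rw [sub_mulVec, sub_eq_zero] at hv0
    rw [← hv0]
    ext i
    simp [Matrix.scalar_apply, mulVec_diagonal]
  set s := ∑ i, ‖v i‖ ^ 2 with hs
  have hs0 : 0 ≤ s := Finset.sum_nonneg fun i _ => by positivity
  have hsne : s ≠ 0 := by
    intro h
    apply hv
    ext i
    have := (Finset.sum_eq_zero_iff_of_nonneg (fun i _ => by positivity)).1 (hs ▸ h) i (Finset.mem_univ i)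
    simpa using this
  set r := Real.sqrt s with hr
  have hrp : 0 < r := Real.sqrt_pos.2 (lt_of_le_of_ne hs0 (Ne.symm hsne))
  have hrr : r * r = s := Real.mul_self_sqrt hs0
  have hrc : (r : ℂ) ≠ 0 := by exact_mod_cast hrp.ne'
  have hsx : star (((r : ℂ)⁻¹) • v) = ((r : ℂ)⁻¹) • star v := by
    rw [star_smul]; simp
  have hx1 : star (((r : ℂ)⁻¹) • v) ⬝ᵥ (((r : ℂ)⁻¹) • v) = 1 := by
    rw [hsx, smul_dotProduct, dotProduct_smul, star_dot_self, ← hs, ← hrr]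
    push_cast
    simp only [smul_eq_mul]; field_simp
  refine ⟨((r : ℂ)⁻¹) • v, hx1, ?_⟩
  rw [mulVec_smul, hTv, smul_comm, dotProduct_smul, hx1]; simp

lemma exists_matSpec (T : Matrix (Fin n) (Fin n) ℂ) (hsep : T.charpoly.Separable) :
    ∃ P lam, MatSpec T P lam ∧ ∀ i, lam i ∈ numRange T := by
  classical
  have hmon := T.charpoly_monic
  have hnd := nodup_roots hsep
  have hcard : T.charpoly.roots.toFinset.card = n := by
    rw [Multiset.toFinset_card_of_nodup hnd, IsAlgClosed.card_roots_eq_natDegree, charpoly_natDegree_eq_dim, Fintype.card_fin]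
  let e := Finset.equivFinOfCardEq hcard
  let lam : Fin n → ℂ := fun i => (e.symm i : ℂ)
  have hinj : Function.Injective lam := Subtype.val_injective.comp e.symm.injective
  have hroot : ∀ i, T.charpoly.IsRoot (lam i) := by
    intro i
    have := (e.symm i).2
    rw [Multiset.mem_toFinset] at this
    exact isRoot_of_mem_roots this
  have hsurj : ∀ z ∈ T.charpoly.roots, ∃ i, lam i = z := by
    intro z hz
    exact ⟨e ⟨z, Multiset.mem_toFinset.2 hz⟩, by simp [lam]⟩
  have hvan : ∀ q : ℂ[X], (∀ i, q.eval (lam i) = 0) → aeval T q = 0 := by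
    intro q hq
    rcases eq_or_ne q 0 with rfl | hq0
    · simp
    have hd : T.charpoly ∣ q := by
      rw [IsAlgClosed.dvd_iff_roots_le_roots hmon.ne_zero hq0, Multiset.le_iff_subset hnd]
      intro z hz
      obtain ⟨i, rfl⟩ := hsurj z hz
      exact (mem_roots hq0).2 (hq i)
    obtain ⟨c, rfl⟩ := hd
    rw [map_mul, aeval_self_charpoly, zero_mul]
  have hcong : ∀ q r : ℂ[X], (∀ i, q.eval (lam i) = r.eval (lam i)) → aeval T q = aeval T r := by
    intro q r h
    rw [← sub_eq_zero, ← map_sub]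
    exact hvan _ fun i => by simp [h i]
  let b : Fin n → ℂ[X] := fun i => Lagrange.basis Finset.univ lam i
  have hb : ∀ i j, (b i).eval (lam j) = if i = j then 1 else 0 := by
    intro i j
    split_ifs with h
    · subst h
      exact Lagrange.eval_basis_self hinj.injOn (Finset.mem_univ _)
    · exact Lagrange.eval_basis_of_ne h (Finset.mem_univ _)
  refine ⟨fun i => aeval T (b i), lam, ⟨?_, ?_, ?_⟩, fun i => eigen_numRange (hroot i)⟩
  · intro i j
    rw [← map_mul]
    split_ifs with h
    · apply hcong
      intro k
      rw [eval_mul, hb, hb]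
      subst h
      split_ifs <;> simp
    · apply hvan
      intro k
      rw [eval_mul, hb, hb]
      split_ifs with h1 h2
      · exact absurd (h1.trans h2.symm) h
      all_goals simp
  · rw [← map_sum, ← map_one (aeval (R := ℂ) T)]
    apply hcong
    intro i
    simp [eval_finsetSum, hb]
  · have : ∀ i, lam i • aeval T (b i) = aeval T (C (lam i) * b i) := by
      intro i
      rw [map_mul, aeval_C, Algebra.algebraMap_eq_smul_one, smul_mul_assoc, one_mul]
    simp_rw [this]
    rw [← map_sum]
    conv_rhs => rw [← aeval_X (R := ℂ) T]
    apply hcong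
    intro i
    simp [eval_finsetSum, hb]

lemma exists_approx (A : Matrix (Fin n) (Fin n) ℂ) :
    ∃ a : ℕ → Matrix (Fin n) (Fin n) ℂ, Filter.Tendsto a Filter.atTop (nhds A) ∧ ∀ k, (a k).charpoly.Separable := by
  let B : Matrix (Fin n) (Fin n) ℂ := diagonal fun i => ((i : ℕ) : ℂ)
  let m : ℂ → Matrix (Fin n) (Fin n) ℂ := fun t => A + t • (B - A)
  let Mt : Matrix (Fin n) (Fin n) ℂ[X] := A.map C + (X : ℂ[X]) • (B - A).map C
  let f := Mt.charpoly
  let R : ℂ[X] := resultant f (derivative f) n (n - 1)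
  have hmap : ∀ t, f.map (evalRingHom t) = (m t).charpoly := by
    intro t
    rw [← charpoly_map]
    congr 1
    ext i j
    simp [Mt, m]
  have hR : ∀ t, R.eval t = resultant (m t).charpoly (derivative (m t).charpoly) := by
    intro t
    have h1 : (m t).charpoly.natDegree = n := by
      rw [charpoly_natDegree_eq_dim, Fintype.card_fin]
    have h2 : (derivative (m t).charpoly).natDegree = n - 1 := by
      rw [natDegree_derivative, h1]
    rw [h1, h2, ← hmap, derivative_map, resultant_map_map]
    rfl
  have hsep : ∀ t, R.eval t ≠ 0 → (m t).charpoly.Separable := by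
    intro t ht
    by_contra h
    apply ht
    rw [hR, resultant_eq_zero_iff]
    exact ⟨Or.inl (charpoly_monic _).ne_zero, h⟩
  have h1 : R.eval 1 ≠ 0 := by
    rw [hR]
    apply resultant_ne_zero
    change Separable _
    have : m 1 = B := by simp [m]
    rw [this, charpoly_diagonal, separable_prod_X_sub_C_iff]
    intro i j h
    exact Fin.ext (Nat.cast_injective (R := ℂ) h)
  have hR0 : R ≠ 0 := by
    intro h; apply h1; rw [h]; simp
  haveI hfin : Finite {t | R.IsRoot t} := finite_setOfPred_isRoot hR0
  have hdense : Dense {t | R.IsRoot t}ᶜ := (Set.toFinite _).countable.dense_compl ℝ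
  obtain ⟨t, ht, ht0⟩ := mem_closure_iff_seq_limit.1 (hdense 0)
  refine ⟨fun k => m (t k), ?_, fun k => hsep _ (ht k)⟩
  have hc : Continuous m := by fun_prop
  have := (hc.tendsto 0).comp ht0
  have e : m 0 = A := by simp [m]
  rw [e] at this
  exact this

lemma numRange_dist (A B : Matrix (Fin n) (Fin n) ℂ) {z : ℂ} (hz : z ∈ numRange B) :
    ∃ w ∈ numRange A, dist z w ≤ ∑ i, ∑ j, ‖B i j - A i j‖ := by
  obtain ⟨x, hx, rfl⟩ := hz
  refine ⟨_, ⟨x, hx, rfl⟩, ?_⟩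
  have hs : ∑ i, ‖x i‖ ^ 2 = 1 := by
    have := star_dot_self x
    rw [hx] at this
    exact_mod_cast this.symm
  have hx1 : ∀ i, ‖x i‖ ≤ 1 := by
    intro i
    have : ‖x i‖ ^ 2 ≤ 1 := by
      rw [← hs]
      exact Finset.single_le_sum (f := fun i => ‖x i‖ ^ 2) (fun i _ => by positivity) (Finset.mem_univ i)
    exact (sq_le_one_iff₀ (norm_nonneg _)).1 this
  rw [dist_eq_norm, ← dotProduct_sub, ← sub_mulVec]
  simp only [dotProduct, mulVec, Finset.mul_sum]
  refine (norm_sum_le _ _).trans (Finset.sum_le_sum fun i _ => (norm_sum_le _ _).trans (Finset.sum_le_sum fun j _ => ?_))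
  rw [norm_mul, norm_mul, Pi.star_apply, norm_star, Matrix.sub_apply]
  calc ‖x i‖ * (‖B i j - A i j‖ * ‖x j‖) ≤ 1 * (‖B i j - A i j‖ * 1) := by
        gcongr
        · exact hx1 i
        · exact hx1 j
    _ = _ := by ring

lemma numRange_eventually {A : Matrix (Fin n) (Fin n) ℂ} {a : ℕ → Matrix (Fin n) (Fin n) ℂ}
    (ha : Filter.Tendsto a Filter.atTop (nhds A)) {E : Set ℂ} (hA : numRange A ⊆ E) {d : ℝ} (hd : 0 < d) :
    ∀ᶠ k in Filter.atTop, numRange (a k) ⊆ Metric.cthickening d E := by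
  have hc : Continuous fun B : Matrix (Fin n) (Fin n) ℂ => ∑ i, ∑ j, ‖B i j - A i j‖ := by
    fun_prop
  have h1 := (hc.tendsto A).comp ha
  simp only [sub_self, norm_zero, Finset.sum_const_zero] at h1
  filter_upwards [h1.eventually_lt_const hd] with k hk z hz
  obtain ⟨w, hw, hzw⟩ := numRange_dist A (a k) hz
  exact Metric.mem_cthickening_of_dist_le z w d E (hA hw) (hzw.trans hk.le)

lemma frob_continuous : Continuous (frobNorm : Matrix (Fin n) (Fin n) ℂ → ℝ) := by
  unfold frobNorm
  fun_prop

lemma aeval_cont (p : ℂ[X]) : Continuous fun T : Matrix (Fin n) (Fin n) ℂ => aeval T p := by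
  simp_rw [aeval_eq_sum_range]
  fun_prop

theorem final_bound (A B : Matrix (Fin n) (Fin n) ℂ) {E : Set ℂ} (hE : IsCompact E) (hEc : Convex ℝ E)
    (hAE : numRange A ⊆ E) (hBE : numRange B ⊆ E) (p : ℂ[X]) {M : ℝ} (hM0 : 0 ≤ M)
    (hM : ∀ z ∈ E, ‖(derivative p).eval z‖ ≤ M) :
    frobNorm (aeval B p - aeval A p) ≤ (1 + Real.sqrt 2) ^ 2 * M * frobNorm (B - A) := by
  obtain ⟨a, ha, hasep⟩ := exists_approx A
  obtain ⟨b, hb, hbsep⟩ := exists_approx B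
  have key : ∀ M' > M, frobNorm (aeval B p - aeval A p) ≤ (1 + Real.sqrt 2) ^ 2 * M' * frobNorm (B - A) := by
    intro M' hM'
    have hopen : IsOpen {z | ‖(derivative p).eval z‖ < M'} :=
      isOpen_lt (derivative p).continuous.norm continuous_const
    obtain ⟨d, hd, hsub⟩ := hE.exists_cthickening_subset_open hopen (fun z hz => (hM z hz).trans_lt hM')
    refine le_of_tendsto_of_tendsto
      ((frob_continuous.tendsto _).comp ((((aeval_cont p).tendsto B).comp hb).sub (((aeval_cont p).tendsto A).comp ha)))
      (((frob_continuous.tendsto _).comp (hb.sub ha)).const_mul _) ?_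
    filter_upwards [numRange_eventually ha hAE hd, numRange_eventually hb hBE hd] with k hka hkb
    obtain ⟨P, lam, hP, hlam⟩ := exists_matSpec _ (hbsep k)
    obtain ⟨Q, rho, hQ, hrho⟩ := exists_matSpec _ (hasep k)
    exact diag_bound hP hQ hE.cthickening (hEc.cthickening d) hkb hka (fun i => hkb (hlam i))
      (fun i => hka (hrho i)) p (hM0.trans hM'.le) (fun z hz => (hsub hz).le)
  have hlim : Filter.Tendsto (fun M' : ℝ => (1 + Real.sqrt 2) ^ 2 * M' * frobNorm (B - A)) (nhdsWithin M (Set.Ioi M))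
      (nhds ((1 + Real.sqrt 2) ^ 2 * M * frobNorm (B - A))) := by
    apply Filter.Tendsto.mono_left _ nhdsWithin_le_nhds
    apply Continuous.tendsto
    fun_prop
  exact ge_of_tendsto hlim (Filter.eventually_of_mem self_mem_nhdsWithin key)

end Final

/-- For `A, D ∈ ℂ^{n×n}` and a compact convex set `E` containing
`W(A) ∪ W(A+D)`, for every polynomial `p`:
`‖p(A+D) − p(A)‖_F ≤ (1+√2)² ⬝ sup_{z∈E} |p'(z)| ⬝ ‖D‖_F`. -/
theorem stmt10 (n : ℕ) (A D : Matrix (Fin n) (Fin n) ℂ) (E : Set ℂ)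
    (hEcompact : IsCompact E) (hEconvex : Convex ℝ E)
    (hE : numRange A ∪ numRange (A + D) ⊆ E) :
    ∀ p : Polynomial ℂ,
      frobNorm (aeval (A + D) p - aeval A p) ≤
        (1 + Real.sqrt 2) ^ 2 *
          sSup ((fun z => ‖(Polynomial.derivative p).eval z‖) '' E) * frobNorm D := by
  intro p
  have hbdd : BddAbove ((fun z => ‖(Polynomial.derivative p).eval z‖) '' E) :=
    (hEcompact.image (Polynomial.derivative p).continuous.norm).bddAbove
  have h := final_bound A (A + D) hEcompact hEconvex (Set.subset_union_left.trans hE)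
    (Set.subset_union_right.trans hE) p
    (M := sSup ((fun z => ‖(Polynomial.derivative p).eval z‖) '' E))
    (Real.sSup_nonneg (by rintro _ ⟨z, _, rfl⟩; exact norm_nonneg _))
    (fun z hz => le_csSup hbdd ⟨z, hz, rfl⟩)
  rwa [add_sub_cancel_left] at h
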